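/- Let G be a fair complete k-partite graph with k ≥ 3 whose edges are coloured red and blue. Then all but at most one vertex of G can be partitioned into a monochromatic path and a monochromatic cycle of distinct colours; that is, there exist a vertex-disjoint red path and blue cycle, or a vertex-disjoint blue path and red cycle, whose vertex sets together cover all but at most one vertex of G. -/

import Mathlib

open SimpleGraph Set

/- Convention: colour `true` is red, colour `false` is blue. -/

/-- The subgraph of `G` consisting of the edges of colour `b`. -/
def monoSubgraph {V : Type*} (G : SimpleGraph V) (c : Sym2 V → Bool) (b : Bool) :
    SimpleGraph V :=
  SimpleGraph.fromEdgeSet {e | e ∈ G.edgeSet ∧ c e = b}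

/-- `S` is the vertex set of a (possibly empty, possibly trivial) path of `G`
all of whose edges have colour `b`. -/
def IsMonoPathSet {V : Type*} (G : SimpleGraph V) (c : Sym2 V → Bool) (b : Bool)
    (S : Set V) : Prop :=
  S = ∅ ∨ ∃ (u v : V) (p : G.Walk u v), p.IsPath ∧ (∀ e ∈ p.edges, c e = b) ∧
    S = {x | x ∈ p.support}

/-- `S` is the vertex set of a (possibly degenerate: empty, single vertex or single edge)
cycle of `G` all of whose edges have colour `b`. -/
def IsMonoCycleSet {V : Type*} (G : SimpleGraph V) (c : Sym2 V → Bool) (b : Bool)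
    (S : Set V) : Prop :=
  S = ∅ ∨ (∃ v, S = {v}) ∨ (∃ u v, G.Adj u v ∧ c s(u, v) = b ∧ S = {u, v}) ∨
    ∃ (v : V) (p : G.Walk v v), p.IsCycle ∧ (∀ e ∈ p.edges, c e = b) ∧
      S = {x | x ∈ p.support}

/-- `M` is a matching of `G` in colour `b` which is connected, i.e. all its edges lie in one
connected component of the subgraph formed by the edges of colour `b`. -/
def IsConnMatching {V : Type*} (G : SimpleGraph V) (c : Sym2 V → Bool) (b : Bool)
    (M : Set (Sym2 V)) : Prop :=
  (∀ e ∈ M, e ∈ G.edgeSet ∧ c e = b) ∧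
  (∀ e ∈ M, ∀ f ∈ M, e ≠ f → ∀ x, x ∈ e → x ∉ f) ∧
  (∀ e ∈ M, ∀ f ∈ M, ∀ x, x ∈ e → ∀ y, y ∈ f → (monoSubgraph G c b).Reachable x y)

/-- The set of vertices covered by a set of edges. -/
def matchSupport {V : Type*} (M : Set (Sym2 V)) : Set V := {x | ∃ e ∈ M, x ∈ e}

/-- The colouring `c` of the (bipartite, with classes `U` and `W`) graph `G` is a split
colouring: `U = A ∪ B`, `W = C ∪ D`, the edges between `A,C` and between `B,D` are blue
(`false`), and the edges between `A,D` and between `B,C` are red (`true`). -/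
def IsSplitColouring {V : Type*} (G : SimpleGraph V) (c : Sym2 V → Bool)
    (U W : Set V) : Prop :=
  ∃ A B C D : Set V,
    A ∪ B = U ∧ Disjoint A B ∧ C ∪ D = W ∧ Disjoint C D ∧
    (∀ u v, G.Adj u v →
      (((u ∈ A ∧ v ∈ C) ∨ (u ∈ C ∧ v ∈ A) ∨ (u ∈ B ∧ v ∈ D) ∨ (u ∈ D ∧ v ∈ B)) →
        c s(u, v) = false)) ∧
    (∀ u v, G.Adj u v →
      (((u ∈ A ∧ v ∈ D) ∨ (u ∈ D ∧ v ∈ A) ∨ (u ∈ B ∧ v ∈ C) ∨ (u ∈ C ∧ v ∈ B)) →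
        c s(u, v) = true))

/-- The colouring `c` of `G` is `δ`-close to a split colouring: one can delete at most
`δ|E(G)|` edges so that the remaining graph is bipartite and the colouring on it is a
split colouring. -/
def CloseToSplit {V : Type*} (G : SimpleGraph V) (c : Sym2 V → Bool) (δ : ℝ) : Prop :=
  ∃ F : Set (Sym2 V), F ⊆ G.edgeSet ∧ (F.ncard : ℝ) ≤ δ * (G.edgeSet.ncard : ℝ) ∧
    ∃ U W : Set V, U ∪ W = Set.univ ∧ Disjoint U W ∧
      (∀ u v, (G.deleteEdges F).Adj u v → ((u ∈ U ∧ v ∈ W) ∨ (u ∈ W ∧ v ∈ U))) ∧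
      IsSplitColouring (G.deleteEdges F) c U W

/-- Symmetric relations `R` and `B` covering exactly the pairs of vertices in distinct classes
of `f`. -/
structure TwoColoured {V : Type*} (f : V → Fin 3) (R B : V → V → Prop) : Prop where
  red_symm : ∀ x y, R x y → R y x
  blue_symm : ∀ x y, B x y → B y x
  cover : ∀ x y, f x ≠ f y → R x y ∨ B x y
  red_ne : ∀ x y, R x y → f x ≠ f y
  blue_ne : ∀ x y, B x y → f x ≠ f y

/-- A red path `P` followed by a blue path `Q`; the step from `P` to `Q` may have any colour. -/
def BiPath {V : Type*} (f : V → Fin 3) (R B : V → V → Prop) (P Q : List V) : Prop :=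
  P.IsChain R ∧ Q.IsChain B ∧ ∀ x ∈ P.getLast?, ∀ y ∈ Q.head?, f x ≠ f y

/-- The vertices of `L` can be arranged as a red path followed by a blue path. -/
def HasBiPath {V : Type*} (f : V → Fin 3) (R B : V → V → Prop) (L : List V) : Prop :=
  ∃ P Q, BiPath f R B P Q ∧ (P ++ Q).Perm L

section BiPath

variable {V : Type*} {f : V → Fin 3} {R B : V → V → Prop}

theorem TwoColoured.swap (h : TwoColoured f R B) : TwoColoured f B R :=
  ⟨h.blue_symm, h.red_symm, fun x y hxy => (h.cover x y hxy).symm, h.blue_ne, h.red_ne⟩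

theorem isChain_reverse_of_symm (hR : ∀ x y, R x y → R y x) {l : List V} (hl : l.IsChain R) :
    l.reverse.IsChain R :=
  List.isChain_reverse.2 (hl.imp fun x y h => hR x y h)

theorem BiPath.swap (h : TwoColoured f R B) {P Q : List V} (hPQ : BiPath f R B P Q) :
    BiPath f B R Q.reverse P.reverse := by
  refine ⟨isChain_reverse_of_symm h.blue_symm hPQ.2.1, isChain_reverse_of_symm h.red_symm hPQ.1, ?_⟩
  simp only [List.getLast?_reverse, List.head?_reverse]
  exact fun x hx y hy => (hPQ.2.2 y hy x hx).symm

theorem HasBiPath.swap (h : TwoColoured f R B) {L : List V} (hL : HasBiPath f R B L) :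
    HasBiPath f B R L := by
  obtain ⟨P, Q, hPQ, hp⟩ := hL
  refine ⟨_, _, hPQ.swap h, ?_⟩
  rw [← List.reverse_append]
  exact (List.reverse_perm _).trans hp

theorem HasBiPath.perm {L L' : List V} (hL : HasBiPath f R B L) (h : L.Perm L') :
    HasBiPath f R B L' := by
  obtain ⟨P, Q, hPQ, hp⟩ := hL
  exact ⟨P, Q, hPQ, hp.trans h⟩

theorem exists_snoc_of_ne_nil {l : List V} (h : l ≠ []) : ∃ l' x, l = l' ++ [x] :=
  ⟨_, _, (List.dropLast_append_getLast h).symm⟩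

/-- A cyclic arrangement consisting of a red path and a blue path absorbs a new vertex next to
a vertex of a different class at which the colour changes. -/
theorem hasBiPath_cons_of_turn (h : TwoColoured f R B) {v a : V} {P Q : List V}
    (hPQ : BiPath f R B (a :: P) Q) (hQ : ∀ y ∈ Q.getLast?, B y a)
    (hP : Q = [] → ∀ y ∈ P.getLast?, f y ≠ f a) (hva : f v ≠ f a) :
    HasBiPath f R B (v :: a :: P ++ Q) := by
  obtain ⟨h1, h2, h3⟩ := hPQ
  rcases h.cover v a hva with hr | hb
  · refine ⟨v :: a :: P, Q, ⟨?_, h2, ?_⟩, List.Perm.refl _⟩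
    · simp_all
    · simpa using h3
  · refine ⟨P, Q ++ [a, v], ⟨h1.tail, ?_, ?_⟩, ?_⟩
    · have := h.blue_symm v a hb
      simp_all [List.isChain_append]
    · rcases List.eq_nil_or_concat P with rfl | ⟨P', p, rfl⟩
      · simp
      · cases Q <;> simp_all [List.getLast?_cons]
    · classical
      rw [List.perm_iff_count]; intro x
      simp only [List.count_append, List.count_cons, List.count_nil]; omega

theorem hasBiPath_cons_of_turn_last (h : TwoColoured f R B) {v a : V} {P Q : List V}
    (hPQ : BiPath f R B (P ++ [a]) Q) (hQ : ∀ y ∈ Q.head?, B y a)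
    (hc : ∀ x ∈ (P ++ [a]).head?, ∀ y ∈ Q.getLast?, f x ≠ f y)
    (hP : Q = [] → ∀ y ∈ P.head?, f y ≠ f a) (hva : f v ≠ f a) :
    HasBiPath f R B (v :: (P ++ [a]) ++ Q) := by
  have h1 : BiPath f R B (a :: P.reverse) Q.reverse := by
    refine ⟨?_, isChain_reverse_of_symm h.blue_symm hPQ.2.1, ?_⟩
    · simpa using isChain_reverse_of_symm h.red_symm hPQ.1
    · intro x hx y hy
      apply hc x _ y
      · simpa using hy
      · simpa [List.getLast?_cons] using hx
  refine (hasBiPath_cons_of_turn (v := v) h h1 ?_ ?_ hva).perm ?_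
  · simpa using hQ
  · simpa using hP
  · classical
    rw [List.perm_iff_count]; intro x
    simp only [List.count_append, List.count_cons, List.count_nil, List.count_reverse]; omega

/-- The same when both vertices of a change-over lie outside the class of the new vertex. -/
theorem hasBiPath_cons_of_junction (h : TwoColoured f R B) {v p q : V} {P Q : List V}
    (hPQ : BiPath f R B (P ++ [p]) (q :: Q))
    (hc : ∀ x ∈ (P ++ [p]).head?, ∀ y ∈ (q :: Q).getLast?, f x ≠ f y)
    (hp : f v ≠ f p) (hq : f v ≠ f q) :
    HasBiPath f R B (v :: (P ++ [p]) ++ q :: Q) := by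
  have hpq : f p ≠ f q := by simpa using hPQ.2.2
  rcases h.cover p q hpq with hr | hb
  · have h1 := hPQ.swap h
    rw [List.reverse_append, List.reverse_cons] at h1
    refine ((hasBiPath_cons_of_turn_last (v := v) h.swap h1 ?_ ?_ ?_ hq).swap h.swap).perm ?_
    · simpa using hr
    · intro x hx y hy
      refine (hc y ?_ x ?_).symm
      · simpa [List.getLast?_cons] using hy
      · simpa [List.getLast?_cons] using hx
    · simp
    · classical
      rw [List.perm_iff_count]; intro x
      simp only [List.count_append, List.count_cons, List.count_nil, List.count_reverse]; omega
  · refine hasBiPath_cons_of_turn_last h hPQ ?_ hc ?_ hp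
    · simpa using h.blue_symm _ _ hb
    · simp

/-- `l` is a path from `x` to `y` in the relation `r`. -/
structure IsSeg (r : V → V → Prop) (x y : V) (l : List V) : Prop where
  chain : l.IsChain r
  head : l.head? = some x
  last : l.getLast? = some y

namespace IsSeg

variable {r : V → V → Prop} {x y z w : V} {l m : List V}

theorem single (r : V → V → Prop) (x : V) : IsSeg r x x [x] := ⟨by simp, rfl, rfl⟩

theorem append (hl : IsSeg r x y l) (hyz : r y z) (hm : IsSeg r z w m) : IsSeg r x w (l ++ m) := by
  obtain ⟨h1, h2, h3⟩ := hl
  obtain ⟨h4, h5, h6⟩ := hm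
  constructor <;> simp_all [List.isChain_append]

theorem cons (hxy : r x y) (hl : IsSeg r y z l) : IsSeg r x z (x :: l) :=
  (single r x).append hxy hl

theorem snoc (hl : IsSeg r x y l) (hyz : r y z) : IsSeg r x z (l ++ [z]) :=
  hl.append hyz (single r z)

theorem pair (hxy : r x y) : IsSeg r x y [x, y] :=
  cons hxy (single r y)

theorem reverse (hr : ∀ x y, r x y → r y x) (hl : IsSeg r x y l) : IsSeg r y x l.reverse := by
  obtain ⟨h1, h2, h3⟩ := hl
  have := isChain_reverse_of_symm hr h1
  constructor <;> simp_all

theorem exists_cons (hl : IsSeg r x y l) : ∃ m, l = x :: m := by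
  cases l with
  | nil => simpa using hl.head
  | cons a l => exact ⟨l, by simpa using hl.head⟩

theorem exists_snoc (hl : IsSeg r x y l) : ∃ m, l = m ++ [y] := by
  have h := hl.last
  rcases eq_or_ne l [] with rfl | hne
  · simp at h
  · obtain ⟨m, a, rfl⟩ := exists_snoc_of_ne_nil hne
    exact ⟨m, by simpa using h⟩

theorem exists_of_ne_nil (hl : l.IsChain r) (hne : l ≠ []) : ∃ x y, IsSeg r x y l := by
  obtain ⟨m, y, rfl⟩ := exists_snoc_of_ne_nil hne
  cases m with
  | nil => exact ⟨y, y, hl, rfl, rfl⟩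
  | cons x m => exact ⟨x, y, hl, rfl, by simp [List.getLast?_cons]⟩

theorem uncons (hl : IsSeg r x y l) :
    l = [x] ∧ x = y ∨ ∃ z m, l = x :: m ∧ r x z ∧ IsSeg r z y m := by
  obtain ⟨m, rfl⟩ := hl.exists_cons
  rcases eq_or_ne m [] with rfl | hne
  · exact Or.inl ⟨rfl, by simpa using hl.last⟩
  · obtain ⟨z, w, hm⟩ := exists_of_ne_nil hl.chain.tail hne
    have hm' : IsSeg r z w m := hm
    obtain rfl : w = y := by
      have h := hl.last
      rw [List.getLast?_cons, hm'.last] at h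
      simpa using h
    refine Or.inr ⟨z, m, rfl, ?_, hm'⟩
    have h := hl.chain
    rw [List.isChain_cons] at h
    exact h.1 z hm'.head

theorem unsnoc (hl : IsSeg r x y l) :
    l = [x] ∧ x = y ∨ ∃ z m, l = m ++ [y] ∧ IsSeg r x z m ∧ r z y := by
  have hl' : IsSeg (flip r) y x l.reverse :=
    ⟨List.isChain_reverse.2 hl.chain, by simp [hl.last], by simp [hl.head]⟩
  rcases hl'.uncons with ⟨h, rfl⟩ | ⟨z, m, h, hz, hm⟩
  · exact Or.inl ⟨by simpa using h, rfl⟩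
  · refine Or.inr ⟨z, m.reverse, by simpa using congrArg List.reverse h, ?_, hz⟩
    exact ⟨List.isChain_reverse.2 hm.chain, by simp [hm.last], by simp [hm.head]⟩

end IsSeg

theorem IsSeg.biPath {p p' q q' : V} {P Q : List V} (hP : IsSeg R p p' P)
    (hQ : IsSeg B q q' Q) (hj : f p' ≠ f q) : BiPath f R B P Q :=
  ⟨hP.chain, hQ.chain, by simpa [hP.last, hQ.head] using hj⟩

theorem hasBiPath_cons_of_blue_last_head (h : TwoColoured f R B) {v p p' q q' : V} {P Q : List V}
    (hP : IsSeg R p p' P) (hQ : IsSeg B q q' Q) (hj : f p' ≠ f q) (hb : B q' p) (hv : f v ≠ f p) :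
    HasBiPath f R B (v :: P ++ Q) := by
  obtain ⟨P, rfl⟩ := hP.exists_cons
  obtain ⟨Q, rfl⟩ := hQ.exists_cons
  exact hasBiPath_cons_of_turn h (hP.biPath hQ hj) (by simpa [hQ.last] using hb) (by simp) hv

theorem hasBiPath_cons_of_blue_junction (h : TwoColoured f R B) {v p p' q q' : V} {P Q : List V}
    (hP : IsSeg R p p' P) (hQ : IsSeg B q q' Q) (hc : f q' ≠ f p) (hb : B p' q)
    (hv : f v ≠ f p') : HasBiPath f R B (v :: P ++ Q) := by
  obtain ⟨P, rfl⟩ := hP.exists_snoc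
  obtain ⟨Q, rfl⟩ := hQ.exists_cons
  exact hasBiPath_cons_of_turn_last h (hP.biPath hQ (h.blue_ne _ _ hb))
    (by simpa using h.blue_symm _ _ hb) (by simpa [hP.head, hQ.last] using hc.symm) (by simp) hv

theorem hasBiPath_cons_of_junction_ne (h : TwoColoured f R B) {v p p' q q' : V} {P Q : List V}
    (hP : IsSeg R p p' P) (hQ : IsSeg B q q' Q) (hj : f p' ≠ f q) (hc : f q' ≠ f p)
    (hv : f v ≠ f p') (hv' : f v ≠ f q) : HasBiPath f R B (v :: P ++ Q) := by
  obtain ⟨P, rfl⟩ := hP.exists_snoc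
  obtain ⟨Q, rfl⟩ := hQ.exists_cons
  exact hasBiPath_cons_of_junction h (hP.biPath hQ hj)
    (by simpa [hP.head, hQ.last] using hc.symm) hv hv'

/-- Absorbing a vertex `v` into a cyclic arrangement both of whose turning vertices `a`, `b` lie in
the class of `v`, when two consecutive vertices `q`, `r` lie outside that class. -/
theorem hasBiPath_cons_of_turns_mem (h : TwoColoured f R B) {v a b u q r w x y : V}
    {S T Q : List V} (hS : IsSeg R u q S) (hT : IsSeg R r w T) (hQ : IsSeg B x y Q)
    (hau : R a u) (hqr : R q r) (hwb : R w b) (hbx : B b x) (hya : B y a)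
    (hav : f v = f a) (hbv : f v = f b) (hq : f v ≠ f q) (hr : f v ≠ f r) :
    HasBiPath f R B (v :: ([a] ++ S ++ T ++ [b]) ++ Q) := by
  classical
  have hs := h.red_symm
  have hs' := h.blue_symm
  have nau := h.red_ne _ _ hau
  have nqr := h.red_ne _ _ hqr
  have nwb := h.red_ne _ _ hwb
  have nbx := h.blue_ne _ _ hbx
  have nya := h.blue_ne _ _ hya
  by_cases haw : B a w
  · refine (hasBiPath_cons_of_blue_junction (v := v) h (hS.append hqr hT)
      (IsSeg.cons (hs' _ _ hya) ((hQ.reverse hs').snoc (hs' _ _ hbx))) ?_ (hs' _ _ haw) ?_).perm ?_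
    · grind
    · grind
    · rw [List.perm_iff_count]; intro x
      simp only [List.count_append, List.count_cons, List.count_nil, List.count_reverse]; omega
  have haw : R a w := (h.cover a w (by grind)).resolve_right haw
  by_cases hby : R b y
  · refine ((hasBiPath_cons_of_blue_junction (v := v) h.swap hQ
      (IsSeg.cons (hs _ _ hwb) ((hT.reverse hs).append (hs _ _ hqr) ((hS.reverse hs).snoc
        (hs _ _ hau)))) ?_ (hs _ _ hby) ?_).swap h.swap).perm ?_
    · grind
    · grind
    · rw [List.perm_iff_count]; intro x
      simp only [List.count_append, List.count_cons, List.count_nil, List.count_reverse]; omega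
  have hby : B b y := (h.cover b y (by grind)).resolve_left hby
  have hP : IsSeg R r q (T ++ a :: S) := hT.append (hs _ _ haw) (IsSeg.cons hau hS)
  have hQ' : IsSeg B x b (Q ++ [b]) := hQ.snoc (hs' _ _ hby)
  by_cases hxq : f x = f q
  · refine (hasBiPath_cons_of_junction_ne (v := v) h (hP.reverse hs) hQ' ?_ ?_ ?_ ?_).perm ?_
    · grind
    · grind
    · grind
    · grind
    · rw [List.perm_iff_count]; intro x
      simp only [List.count_append, List.count_cons, List.count_nil, List.count_reverse]; omega
  · refine (hasBiPath_cons_of_junction_ne (v := v) h hP hQ' ?_ ?_ ?_ ?_).perm ?_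
    · grind
    · grind
    · grind
    · grind
    · rw [List.perm_iff_count]; intro x
      simp only [List.count_append, List.count_cons, List.count_nil]; omega

theorem HasBiPath.of_count {L L' : List V} [DecidableEq V] (hL : HasBiPath f R B L)
    (h : ∀ x, L.count x = L'.count x := by
      intro x
      simp only [List.count_append, List.count_cons, List.count_nil, List.count_reverse] <;>
        omega) :
    HasBiPath f R B L' :=
  hL.perm (List.perm_iff_count.2 h)

theorem IsSeg.closed_absorb (h : TwoColoured f R B) {a b v : V} {P : List V} (hP : IsSeg R a b P)
    (hba : f b ≠ f a) (hva : f v ≠ f a) : HasBiPath f R B (v :: P) := by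
  classical
  obtain ⟨P, rfl⟩ := hP.exists_cons
  refine (hasBiPath_cons_of_turn (v := v) (Q := []) h ⟨hP.chain, by simp, by simp⟩ (by simp)
    ?_ hva).of_count
  intro _ y hy
  have := hP.last
  rcases eq_or_ne P [] with rfl | hne
  · simp at hy
  · simp_all [List.getLast?_cons]

/-- A cyclic arrangement with two consecutive vertices `q`, `r` on its red path absorbs any vertex
whose class contains neither of them. -/
theorem hasBiPath_cons_of_cyclic_red (h : TwoColoured f R B) {v q r : V} (hq : f v ≠ f q)
    (hr : f v ≠ f r) (hqr : R q r) (n : ℕ) : ∀ (a b : V) (S T Q : List V), Q.length = n →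
    IsSeg R a q S → IsSeg R r b T → Q.IsChain B → (∀ x ∈ Q.head?, f b ≠ f x) →
    (∀ y ∈ Q.getLast?, f y ≠ f a) → (Q = [] → f b ≠ f a) →
    HasBiPath f R B (v :: (S ++ T) ++ Q) := by
  classical
  have hs := h.red_symm
  induction n with
  | zero =>
    intro a b S T Q hn hS hT _ _ _ hba
    obtain rfl : Q = [] := List.eq_nil_of_length_eq_zero hn
    have hba := hba rfl
    rcases h.cover b a hba with hbr | _
    · exact ((hT.append hbr hS).closed_absorb h (h.red_ne _ _ hqr) hr).of_count
    · by_cases hva : f v = f a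
      · exact (((hS.append hqr hT).reverse hs).closed_absorb h hba.symm
          (by rw [hva]; exact hba.symm)).of_count
      · exact ((hS.append hqr hT).closed_absorb h hba hva).of_count
  | succ n ih =>
    intro a b S T Q hn hS hT hQ hbx hya _
    obtain ⟨x, y, hQ⟩ := IsSeg.exists_of_ne_nil hQ (by rintro rfl; simp at hn)
    simp only [hQ.head, hQ.last, Option.mem_def, Option.some.injEq, forall_eq'] at hbx hya
    by_cases hyr : R y a
    · rcases hQ.unsnoc with ⟨rfl, rfl⟩ | ⟨z, Q, rfl, hQ', hzy⟩
      · exact (ih x b (x :: S) T [] (by simp at hn ⊢; omega) (hS.cons hyr) hT (by simp) (by simp)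
          (by simp) (fun _ => hbx)).of_count
      · refine (ih y b (y :: S) T Q (by simpa using hn) (hS.cons hyr) hT hQ'.chain ?_ ?_
          ?_).of_count
        · simpa [hQ'.head] using hbx
        · simpa [hQ'.last] using h.blue_ne _ _ hzy
        · rintro rfl
          simpa using hQ'.head
    have hyb := (h.cover y a hya).resolve_left hyr
    by_cases hxr : R b x
    · rcases hQ.uncons with ⟨rfl, rfl⟩ | ⟨z, Q, rfl, hxz, hQ'⟩
      · exact (ih a x S (T ++ [x]) [] (by simp at hn ⊢; omega) hS (hT.snoc hxr) (by simp) (by simp)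
          (by simp) (fun _ => hya)).of_count
      · refine (ih a x S (T ++ [x]) Q (by simpa using hn) hS (hT.snoc hxr) hQ'.chain ?_ ?_
          ?_).of_count
        · simpa [hQ'.head] using h.blue_ne _ _ hxz
        · simpa [hQ'.last] using hya
        · rintro rfl
          simpa using hQ'.head
    have hxb := (h.cover b x hbx).resolve_left hxr
    by_cases hva : f v = f a
    swap
    · exact hasBiPath_cons_of_blue_last_head h (hS.append hqr hT) hQ hbx hyb hva
    by_cases hvb : f v = f b
    swap
    · exact hasBiPath_cons_of_blue_junction h (hS.append hqr hT) hQ hya hxb hvb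
    rcases hS.uncons with ⟨-, rfl⟩ | ⟨u, S, rfl, hau, hS⟩
    · exact absurd hva hq
    rcases hT.unsnoc with ⟨-, rfl⟩ | ⟨w, T, rfl, hT, hwb⟩
    · exact absurd hvb hr
    exact (hasBiPath_cons_of_turns_mem h hS hT hQ hau hqr hwb hxb hyb hva hvb hq hr).of_count

theorem length_le_of_isChain {i : Fin 3} : ∀ {H : List V},
    H.IsChain (fun x y => f x = i ∨ f y = i) → H.length ≤ 2 * H.countP (f · = i) + 1
  | [], _ => by simp
  | [a], _ => by simp
  | a :: b :: t, hH => by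
    rw [List.isChain_cons_cons] at hH
    obtain ⟨hab, hbt⟩ := hH
    by_cases ha : f a = i
    · have := length_le_of_isChain hbt
      rw [List.countP_cons_of_pos (by simpa using ha), List.length_cons]
      omega
    · have hb := hab.resolve_left ha
      have := length_le_of_isChain hbt.tail
      rw [List.countP_cons_of_neg (by simpa using ha), List.countP_cons_of_pos (by simpa using hb),
        List.length_cons, List.length_cons]
      simp only [List.tail_cons] at this
      omega

theorem IsSeg.exists_split {r s : V → V → Prop} : ∀ {l : List V} {x y : V}, IsSeg r x y l →
    ¬ l.IsChain s → ∃ q z S T, l = S ++ T ∧ IsSeg r x q S ∧ r q z ∧ IsSeg r z y T ∧ ¬ s q z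
  | [], _, _, _, hs => absurd List.IsChain.nil hs
  | a :: l, x, y, hl, hs => by
    obtain rfl : a = x := by simpa using hl.head
    rcases hl.uncons with ⟨h, -⟩ | ⟨z, m, h, haz, hm⟩
    · rw [h] at hs
      simp at hs
    · obtain rfl : l = m := by simpa using h
      by_cases hsaz : s a z
      · have : ¬ l.IsChain s := by
          intro hc
          refine hs (List.isChain_cons.2 ⟨?_, hc⟩)
          simpa [hm.head] using hsaz
        obtain ⟨q, w, S, T, rfl, h1, h2, h3, h4⟩ := hm.exists_split this
        exact ⟨q, w, a :: S, T, rfl, h1.cons haz, h2, h3, h4⟩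
      · exact ⟨a, z, [a], l, rfl, IsSeg.single r a, haz, hm, hsaz⟩

theorem absorb_of_not_isChain_red (h : TwoColoured f R B) {v : V} {P Q : List V}
    (hPQ : BiPath f R B P Q)
    (hc : ∀ x ∈ (P ++ Q).head?, ∀ y ∈ (P ++ Q).getLast?, f y ≠ f x)
    (hM : ¬ P.IsChain (fun x y => f x = f v ∨ f y = f v)) : HasBiPath f R B (v :: P ++ Q) := by
  obtain ⟨a, b, hP⟩ := IsSeg.exists_of_ne_nil hPQ.1 (by rintro rfl; simp at hM)
  have hj := hPQ.2.2
  simp only [hP.last, Option.mem_def, Option.some.injEq, forall_eq'] at hj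
  simp only [List.head?_append, hP.head, List.getLast?_append, hP.last] at hc
  obtain ⟨q, r, S, T, rfl, hS, hqr, hT, hn⟩ := hP.exists_split hM
  push Not at hn
  refine hasBiPath_cons_of_cyclic_red h hn.1.symm hn.2.symm hqr _ a b S T Q rfl hS hT hPQ.2.1 hj
    ?_ ?_
  · intro y hy
    exact hc a rfl y (by simp_all)
  · rintro rfl
    exact hc a rfl b rfl

/-- A red-blue path with ends in distinct classes absorbs any vertex. -/
theorem absorb_of_ends_ne (h : TwoColoured f R B) {v : V} {P Q : List V}
    (hPQ : BiPath f R B P Q)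
    (hc : ∀ x ∈ (P ++ Q).head?, ∀ y ∈ (P ++ Q).getLast?, f y ≠ f x)
    (hM : 2 * (P ++ Q).countP (f · = f v) + 1 < (P ++ Q).length) :
    HasBiPath f R B (v :: P ++ Q) := by
  classical
  by_cases hP : P.IsChain (fun x y => f x = f v ∨ f y = f v)
  swap
  · exact absorb_of_not_isChain_red h hPQ hc hP
  by_cases hQ : Q.IsChain (fun x y => f x = f v ∨ f y = f v)
  swap
  · refine ((absorb_of_not_isChain_red (v := v) h.swap (hPQ.swap h) ?_ ?_).swap h.swap).of_count
    · rw [← List.reverse_append, List.head?_reverse, List.getLast?_reverse]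
      exact fun x hx y hy => (hc y hy x hx).symm
    · intro hn
      exact hQ (by simpa using isChain_reverse_of_symm (fun x y => Or.symm) hn)
  have hPQn : ¬ (P ++ Q).IsChain (fun x y => f x = f v ∨ f y = f v) := fun hn => by
    have := length_le_of_isChain hn
    omega
  rw [List.isChain_append] at hPQn
  push Not at hPQn
  obtain ⟨p, hp, q, hq, hpv, hqv⟩ := hPQn hP hQ
  obtain ⟨a, p', hP'⟩ := IsSeg.exists_of_ne_nil hPQ.1 (by rintro rfl; simp at hp)
  obtain ⟨q', b, hQ'⟩ := IsSeg.exists_of_ne_nil hPQ.2.1 (by rintro rfl; simp at hq)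
  obtain rfl : p' = p := by simpa [hP'.last] using hp
  obtain rfl : q' = q := by simpa [hQ'.head] using hq
  refine hasBiPath_cons_of_junction_ne h hP' hQ' (hPQ.2.2 _ hp _ hq) ?_ hpv.symm hqv.symm
  exact hc a (by simp [hP'.head]) b (by simp [hQ'.last])

theorem IsSeg.hasBiPath {p p' q q' : V} {P Q L : List V} [DecidableEq V] (hP : IsSeg R p p' P)
    (hQ : IsSeg B q q' Q) (hj : f p' ≠ f q)
    (hL : ∀ x, (P ++ Q).count x = L.count x := by
      intro x
      simp only [List.count_append, List.count_cons, List.count_nil, List.count_reverse] <;>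
        omega) :
    HasBiPath f R B L :=
  ⟨P, Q, hP.biPath hQ hj, List.perm_iff_count.2 hL⟩

theorem IsSeg.absorb_of_ends_ne (h : TwoColoured f R B) {v p p' q q' : V} {P Q L : List V}
    [DecidableEq V] (hP : IsSeg R p p' P) (hQ : IsSeg B q q' Q) (hj : f p' ≠ f q)
    (hc : f q' ≠ f p) (hM : 2 * L.countP (f · = f v) + 1 < L.length)
    (hL : ∀ x, (P ++ Q).count x = L.count x := by
      intro x
      simp only [List.count_append, List.count_cons, List.count_nil, List.count_reverse] <;>
        omega) :
    HasBiPath f R B (v :: L) := by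
  have hp := List.perm_iff_count.2 hL
  refine (_root_.absorb_of_ends_ne (v := v) h (hP.biPath hQ hj) ?_ ?_).perm (hp.cons v)
  · simpa [hP.head, hQ.last] using hc
  · rwa [hp.countP_eq, hp.length_eq]

/-- Constraints on a vertex `v` that cannot be absorbed by a red-blue path `A, d, Q` turning at `d`,
both ends of which lie in a common class different from that of `v`. -/
theorem classes_of_not_hasBiPath (h : TwoColoured f R B) {v a c d e g : V} {A Q : List V}
    (hA : IsSeg R a c A) (hcd : R c d) (hde : B d e) (hQ : IsSeg B e g Q) (hag : f a = f g)
    (hva : f v ≠ f a) (hM : 2 * (A ++ d :: Q).countP (f · = f v) + 1 < (A ++ d :: Q).length)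
    (hn : ¬ HasBiPath f R B (v :: (A ++ d :: Q))) :
    B v a ∧ R v g ∧ f d = f v ∧ f c = f a ∧ f e = f a ∧ B v c := by
  classical
  have hs := h.red_symm
  have hs' := h.blue_symm
  have hcd' := h.red_ne _ _ hcd
  have hde' := h.blue_ne _ _ hde
  have hBva : B v a := by
    refine (h.cover v a hva).resolve_left fun hr => hn ?_
    exact ((hA.snoc hcd).cons hr).hasBiPath hQ hde'
  have hRvg : R v g := by
    refine (h.cover v g (hag ▸ hva)).resolve_right fun hr => hn ?_
    exact hA.hasBiPath ((hQ.cons hde).snoc (hs' _ _ hr)) hcd'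
  have hdv : f d = f v := by
    by_contra hdv
    rcases h.cover d v hdv with hr | hb
    · exact hn (((hA.snoc hcd).snoc hr).hasBiPath (hQ.reverse hs') (hag ▸ hva))
    · exact hn ((hA.reverse hs).hasBiPath ((hQ.cons hde).cons (hs' _ _ hb)) hva.symm)
  refine ⟨hBva, hRvg, hdv, ?_, ?_, ?_⟩
  · by_contra hc
    exact hn ((hA.reverse hs).absorb_of_ends_ne h (hQ.cons hde) (by grind) (by grind) hM)
  · by_contra hc
    exact hn ((hA.snoc hcd).absorb_of_ends_ne h (hQ.reverse hs') (by grind) (by grind) hM)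
  · have hca : f c = f a := by
      by_contra hc
      exact hn ((hA.reverse hs).absorb_of_ends_ne h (hQ.cons hde) (by grind) (by grind) hM)
    refine (h.cover v c (hca ▸ hva)).resolve_left fun hr => hn ?_
    exact ((hA.reverse hs).cons hr).hasBiPath (hQ.cons hde) (by grind)

theorem absorb_of_pair_red (h : TwoColoured f R B) {v a r s c d e g : V} {S T Q : List V}
    (hS : IsSeg R a r S) (hrs : R r s) (hT : IsSeg R s c T)
    (hcd : R c d) (hde : B d e) (hQ : IsSeg B e g Q) (hag : f a = f g)
    (hva : f v ≠ f a) (hra : f r ≠ f a) (hsa : f s ≠ f a)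
    (hM : 2 * (S ++ T ++ d :: Q).countP (f · = f v) + 1 < (S ++ T ++ d :: Q).length) :
    HasBiPath f R B (v :: (S ++ T ++ d :: Q)) := by
  classical
  have hs := h.red_symm
  have hs' := h.blue_symm
  by_contra hn
  obtain ⟨hBva, hRvg, hdv, hca, hea, hBvc⟩ :=
    classes_of_not_hasBiPath h (hS.append hrs hT) hcd hde hQ hag hva hM hn
  rcases h.cover a d (by grind) with hr | hb
  · exact hn (((hT.snoc hcd).append (hs _ _ hr) hS).absorb_of_ends_ne h (hQ.reverse hs')
      (by grind) (by grind) hM)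
  · rcases hS.uncons with ⟨-, rfl⟩ | ⟨u, S, rfl, hau, hS⟩
    · exact hra rfl
    rcases hT.unsnoc with ⟨-, rfl⟩ | ⟨w, T, rfl, hT, hwc⟩
    · exact hsa hca
    exact hn ((hS.append hrs hT).hasBiPath
      ((((hQ.cons hde).cons hb).cons hBva).cons (hs' _ _ hBvc)) (h.red_ne _ _ hwc))

/-- A red-blue path both of whose ends lie in a class `L` absorbs any vertex outside `L`. -/
theorem absorb_of_ends_eq (h : TwoColoured f R B) {v : V} {i : Fin 3} (hvi : f v ≠ i) (n : ℕ) :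
    ∀ {P Q : List V}, Q.length = n → BiPath f R B P Q →
    (∀ x ∈ (P ++ Q).head?, f x = i) → (∀ y ∈ (P ++ Q).getLast?, f y = i) →
    2 * (P ++ Q).countP (f · = f v) + 1 < (P ++ Q).length →
    2 * (P ++ Q).countP (f · = i) ≤ (P ++ Q).length →
    HasBiPath f R B (v :: (P ++ Q)) := by
  classical
  have hs := h.red_symm
  have hs' := h.blue_symm
  have key : ∀ {P : List V} {R' B' : V → V → Prop}, TwoColoured f R' B' →
      P.IsChain R' → (∀ x ∈ P.head?, f x = i) → HasBiPath f R' B' (v :: P) := by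
    intro P R' B' h' hP hi
    rcases eq_or_ne P [] with rfl | hne
    · exact ⟨[v], [], ⟨by simp, by simp, by simp⟩, by simp⟩
    obtain ⟨a, b, hP⟩ := IsSeg.exists_of_ne_nil hP hne
    have ha : f v ≠ f a := by rwa [hi a hP.head]
    rcases h'.cover v a ha with hr | hb
    · exact ⟨v :: P, [], ⟨(hP.cons hr).chain, by simp, by simp⟩, by simp⟩
    · refine ((hP.reverse h'.red_symm).hasBiPath (IsSeg.single B' v) ha.symm)
  induction n with
  | zero =>
    intro P Q hn hPQ hi _ _ _
    obtain rfl : Q = [] := List.eq_nil_of_length_eq_zero hn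
    simp only [List.append_nil] at hi ⊢
    exact key h hPQ.1 hi
  | succ n ih =>
    intro P Q hn hPQ hi hi' hM hL
    obtain ⟨e, g, hQ⟩ := IsSeg.exists_of_ne_nil hPQ.2.1 (by rintro rfl; simp at hn)
    rcases eq_or_ne P [] with rfl | hne
    · exact ((key h.swap (hQ.reverse hs').chain (by simpa using hi')).swap h.swap).of_count
    obtain ⟨a, d, hP⟩ := IsSeg.exists_of_ne_nil hPQ.1 hne
    have hde := hPQ.2.2 d hP.last e hQ.head
    rcases h.cover d e hde with hr | hb
    · obtain ⟨Q, rfl⟩ := hQ.exists_cons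
      have e1 : P ++ e :: Q = (P ++ [e]) ++ Q := by simp
      rw [e1] at hi hi' hM hL ⊢
      refine ih (by simpa using hn) ⟨(hP.snoc hr).chain, hQ.chain.tail, ?_⟩ hi hi' hM hL
      have := hQ.chain
      rw [List.isChain_cons] at this
      simpa using fun y hy => h.blue_ne _ _ (this.1 y hy)
    have hai : f a = i := hi a (by simp [hP.head])
    have hgi : f g = i := hi' g (by simp [hQ.last])
    subst hai
    rcases hP.unsnoc with ⟨rfl, rfl⟩ | ⟨c, A, rfl, hA, hcd⟩
    · refine ((key h.swap ((hQ.cons hb).reverse hs').chain ?_).swap h.swap).of_count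
      simpa [List.getLast?_cons] using hi'
    have e1 : A ++ [d] ++ Q = A ++ d :: Q := by simp
    rw [e1] at hM hL ⊢
    by_contra hnot
    obtain ⟨hBva, hRvg, hdv, hca, hea, hBvc⟩ :=
      classes_of_not_hasBiPath h hA hcd hb hQ hgi.symm hvi hM hnot
    have hchain : ¬ (A ++ d :: Q).IsChain (fun x y => f x = f a ∨ f y = f a) := by
      intro hc
      obtain ⟨A, rfl⟩ := hA.exists_cons
      obtain ⟨Q, rfl⟩ := hQ.exists_snoc
      have e2 : a :: A ++ d :: (Q ++ [g]) = a :: (A ++ d :: Q) ++ [g] := by simp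
      rw [e2] at hc hL
      have := length_le_of_isChain (List.isChain_append.1 hc).1.tail
      rw [List.tail_cons] at this
      rw [List.countP_append, List.countP_cons_of_pos (by simp),
        List.countP_cons_of_pos (by simpa using hgi), List.length_append, List.length_cons,
        List.length_singleton, List.countP_nil] at hL
      omega
    by_cases hcA : A.IsChain (fun x y => f x = f a ∨ f y = f a)
    swap
    · obtain ⟨r, s, S, T, rfl, hS, hrs, hT, hrs'⟩ := hA.exists_split hcA
      push Not at hrs'
      exact hnot (absorb_of_pair_red h hS hrs hT hcd hb hQ hgi.symm hvi hrs'.1 hrs'.2 hM)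
    by_cases hcQ : Q.reverse.IsChain (fun x y => f x = f a ∨ f y = f a)
    swap
    · obtain ⟨r, s, S, T, hST, hS, hrs, hT, hrs'⟩ := (hQ.reverse hs').exists_split hcQ
      push Not at hrs'
      have hp : (S ++ T ++ d :: A.reverse).Perm (A ++ d :: Q) := by
        rw [← hST, List.perm_iff_count]
        intro x
        simp only [List.count_append, List.count_cons, List.count_reverse]
        omega
      refine hnot (((absorb_of_pair_red (v := v) h.swap hS hrs hT (hs' _ _ hb) (hs _ _ hcd)
        (hA.reverse hs) hgi (hgi ▸ hvi) (hgi ▸ hrs'.1) (hgi ▸ hrs'.2) ?_).swap h.swap).perm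
        (hp.cons v))
      rwa [hp.countP_eq, hp.length_eq]
    · refine hchain (List.isChain_append.2 ⟨hcA, List.isChain_cons.2 ⟨?_, ?_⟩, ?_⟩)
      · simpa [hQ.head] using Or.inr hea
      · simpa using isChain_reverse_of_symm (fun x y => Or.symm) hcQ
      · simpa [hA.last] using Or.inl hca

theorem BiPath.ends_eq_of_not_hasBiPath (h : TwoColoured f R B) {v : V} {P Q L : List V}
    (hPQ : BiPath f R B P Q) (hp : (v :: (P ++ Q)).Perm L)
    (hL : ∀ i, 2 * L.countP (f · = i) < L.length) (hn : ¬ HasBiPath f R B L) {x y : V}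
    (hx : (P ++ Q).head? = some x) (hy : (P ++ Q).getLast? = some y) : f x = f v ∧ f y = f v := by
  have hM : 2 * (P ++ Q).countP (f · = f v) + 1 < (P ++ Q).length := by
    have := hL (f v)
    rw [← hp.countP_eq, ← hp.length_eq, List.countP_cons_of_pos (by simp), List.length_cons] at this
    omega
  have hxy : f y = f x := by
    by_contra hc
    exact hn ((absorb_of_ends_ne (v := v) h hPQ (by simpa [hx, hy] using hc) hM).perm hp)
  suffices f x = f v from ⟨this, hxy.trans this⟩
  by_contra hxv
  refine hn ((absorb_of_ends_eq h (i := f x) (Ne.symm hxv) _ rfl hPQ (by simp [hx])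
    (by simpa [hy] using hxy) hM ?_).perm hp)
  have := hL (f x)
  rw [← hp.countP_eq, ← hp.length_eq, List.countP_cons_of_neg (by simpa using Ne.symm hxv),
    List.length_cons] at this
  omega

theorem IsSeg.ends_eq (h : TwoColoured f R B) {L : List V} [DecidableEq V]
    (hL : ∀ i, 2 * L.countP (f · = i) < L.length) (hn : ¬ HasBiPath f R B L)
    {p p' q q' : V} {P Q : List V} (hP : IsSeg R p p' P) (hQ : IsSeg B q q' Q) (hj : f p' ≠ f q)
    (v : V) (hp : ∀ x, (P ++ Q ++ [v]).count x = L.count x := by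
      intro x
      simp only [List.count_append, List.count_cons, List.count_nil, List.count_reverse] <;>
        omega) :
    f p = f v ∧ f q' = f v := by
  refine (hP.biPath hQ hj).ends_eq_of_not_hasBiPath h ?_ hL hn (by simp [hP.head])
    (by simp [hQ.last])
  exact (List.perm_append_singleton v (P ++ Q)).symm.trans (List.perm_iff_count.2 hp)

theorem IsSeg.ends_eq_red (h : TwoColoured f R B) {L : List V} [DecidableEq V]
    (hL : ∀ i, 2 * L.countP (f · = i) < L.length) (hn : ¬ HasBiPath f R B L)
    {p p' : V} {P : List V} (hP : IsSeg R p p' P)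
    (v : V) (hp : ∀ x, (P ++ [v]).count x = L.count x := by
      intro x
      simp only [List.count_append, List.count_cons, List.count_nil, List.count_reverse] <;>
        omega) :
    f p = f v ∧ f p' = f v := by
  refine BiPath.ends_eq_of_not_hasBiPath (P := P) (Q := []) h ⟨hP.chain, by simp, by simp⟩ ?_ hL hn
    (by simp [hP.head]) (by simp [hP.last])
  rw [List.append_nil]
  exact (List.perm_append_singleton v P).symm.trans (List.perm_iff_count.2 hp)

theorem fin_three_cases :
    ∀ {i j k : Fin 3}, i ≠ k → j ≠ k → i ≠ j → ∀ l, l = k ∨ l = i ∨ l = j := by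
  decide

theorem hasBiPath_of_transversal_of_red (h : TwoColoured f R B) {a b c d u w z : V} {T : List V}
    (hL : ∀ i, 2 * (a :: T ++ [d, u, w, z]).countP (f · = i) < (a :: T ++ [d, u, w, z]).length)
    (hT : IsSeg R b c T) (hab : R a b) (hcd : R c d)
    (hdu : f d = f u) (hwu : f w ≠ f u) (hzu : f z ≠ f u) (hwz : f w ≠ f z) (hcw : f c = f w) :
    HasBiPath f R B (a :: T ++ [d, u, w, z]) := by
  classical
  have hs := h.red_symm
  have hb := h.blue_symm
  have nab := h.red_ne _ _ hab
  have ncd := h.red_ne _ _ hcd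
  by_contra hn
  have c1 : B d w → B d z → f c ≠ f z → f w = f u := fun hdw hdz ncz =>
      (IsSeg.ends_eq h hL hn (hT.cons hab) ((IsSeg.pair hdw).cons (hb _ _ hdz)) ncz u).2
  have c2 : B u z → f d ≠ f z → f u = f w := fun huz ndz =>
      (IsSeg.ends_eq h hL hn ((hT.snoc hcd).cons hab) (IsSeg.pair (hb _ _ huz)) ndz w).2
  have c3 : B d z → B a d → B a u → f c ≠ f u → f z = f w := fun hdz had hau ncu =>
      (IsSeg.ends_eq h hL hn hT (((IsSeg.pair hdz).cons had).cons (hb _ _ hau)) ncu w).2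
  have c4 : R a d → R d w → f c ≠ f u → f w = f z := fun had hdw ncu =>
      (IsSeg.ends_eq h hL hn (((hT.cons hab).cons (hs _ _ had)).cons (hs _ _ hdw)) (IsSeg.single B
        u) ncu z).1
  have c5 : R u z → R d z → f u = f w := fun huz hdz =>
      (IsSeg.ends_eq_red h hL hn ((hT.append hcd ((IsSeg.pair (hs _ _ huz)).cons hdz)).cons hab)
        w).2
  have c6 : R a u → f u ≠ f w → f d = f z := fun hau nuw =>
      (IsSeg.ends_eq h hL hn (((hT.reverse hs).append (hs _ _ hab) (IsSeg.pair hau)).cons (hs _ _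
        hcd)) (IsSeg.single B w) nuw z).1
  have c7 : R d w → f a ≠ f z → f w = f u := fun hdw naz =>
      (IsSeg.ends_eq h hL hn ((((hT.reverse hs).snoc (hs _ _ hab)).cons (hs _ _ hcd)).cons (hs _ _
        hdw)) (IsSeg.single B z) naz u).1
  have ka := fin_three_cases hwu hzu hwz (f a)
  have kb := fin_three_cases hwu hzu hwz (f b)
  have e1 := h.cover a d
  have e2 := h.cover a u
  have e3 := h.cover d w
  have e4 := h.cover d z
  have e5 := h.cover u z
  clear hL hn hT h hs hb
  grind

theorem hasBiPath_of_transversal_of_long_blue (h : TwoColoured f R B)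
    {a b c d e p q u w z : V} {S T : List V}
    (hL : ∀ i, 2 * (a :: S ++ [d] ++ e :: T ++ [u, w, z]).countP (f · = i) <
      (a :: S ++ [d] ++ e :: T ++ [u, w, z]).length)
    (hS : IsSeg R b c S) (hT : IsSeg B p q T) (hab : R a b) (hcd : R c d) (hde : B d e)
    (hep : B e p)
    (hdu : f d = f u) (hwu : f w ≠ f u) (hzu : f z ≠ f u) (hwz : f w ≠ f z) (hcu : f c ≠ f u)
    (haw : f a = f w) (hew : f e = f w) (hqw : f q = f w) :
    HasBiPath f R B (a :: S ++ [d] ++ e :: T ++ [u, w, z]) := by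
  classical
  have hs := h.red_symm
  have hb := h.blue_symm
  have nab := h.red_ne _ _ hab
  have ncd := h.red_ne _ _ hcd
  have nde := h.blue_ne _ _ hde
  have nep := h.blue_ne _ _ hep
  by_contra hn
  have c1 : R a u → B e z → f d ≠ f z → f u = f w := fun hau hez ndz =>
      (IsSeg.ends_eq h hL hn (((hS.snoc hcd).cons hab).cons (hs _ _ hau)) ((hT.cons hep).cons (hb _
        _ hez)) ndz w).1
  have c2 : B a u → B a z → B d z → f b ≠ f q → f u = f w := fun hau haz hdz nbq =>
      (IsSeg.ends_eq h hL hn (hS.reverse hs) ((hT.reverse hb).append (hb _ _ hep) ((((IsSeg.pair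
        hau).cons (hb _ _ haz)).cons hdz).cons (hb _ _ hde))) nbq w).2
  have c3 : B a u → B u w → B d w → f b ≠ f q → f a = f z := fun hau huw hdw nbq =>
      (IsSeg.ends_eq h hL hn (hS.reverse hs) ((hT.reverse hb).append (hb _ _ hep) ((((IsSeg.pair
        (hb _ _ hau)).cons (hb _ _ huw)).cons hdw).cons (hb _ _ hde))) nbq z).2
  have c4 : R d z → B q u → f e ≠ f z → f u = f w := fun hdz hqu nez =>
      (IsSeg.ends_eq h hL hn ((hS.append hcd (IsSeg.pair hdz)).cons hab) ((hT.snoc hqu).cons hep)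
        nez.symm w).2
  have c5 : R d z → R w z → R u w → f b ≠ f e → f u = f a := fun hdz hwz huw nbe =>
      (IsSeg.ends_eq h hL hn (((((hS.reverse hs).cons (hs _ _ hcd)).cons (hs _ _ hdz)).cons
        hwz).cons huw) (hT.cons hep) nbe a).1
  have c6 : R a z → B d w → f w ≠ f z → f c = f u := fun haz hdw nwz =>
      (IsSeg.ends_eq h hL hn ((hS.reverse hs).append (hs _ _ hab) (IsSeg.pair haz)) (((hT.cons
        hep).cons hde).cons (hb _ _ hdw)) nwz.symm u).1
  have c7 : R a u → B d z → f q ≠ f u → f z = f w := fun hau hdz nqu =>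
      (IsSeg.ends_eq h hL hn ((hS.reverse hs).append (hs _ _ hab) (IsSeg.pair hau)) ((hT.reverse
        hb).append (hb _ _ hep) ((IsSeg.pair hdz).cons (hb _ _ hde))) nqu.symm w).2
  have c8 : R a z → R d w → f e ≠ f z → f w = f u := fun haz hdw nez =>
      (IsSeg.ends_eq h hL hn ((((hS.reverse hs).append (hs _ _ hab) (IsSeg.pair haz)).cons (hs _ _
        hcd)).cons (hs _ _ hdw)) (hT.cons hep) nez.symm u).1
  have c9 : R w z → R d w → f e ≠ f z → f a = f u := fun hwz hdw nez =>
      (IsSeg.ends_eq h hL hn ((hS.append hcd ((IsSeg.pair hwz).cons hdw)).cons hab) (hT.cons hep)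
        nez.symm u).1
  have c10 : R d z → R e z → R e u → f a ≠ f p → f u = f w := fun hdz hez heu nap =>
      (IsSeg.ends_eq h hL hn ((((((hS.reverse hs).snoc (hs _ _ hab)).cons (hs _ _ hcd)).cons (hs _
        _ hdz)).cons hez).cons (hs _ _ heu)) hT nap w).1
  have c11 : B e z → B w z → f d ≠ f w → f a = f u := fun hez hwz ndw =>
      (IsSeg.ends_eq h hL hn ((hS.snoc hcd).cons hab) (((hT.cons hep).cons (hb _ _ hez)).cons hwz)
        ndw u).1
  have c12 : R a u → R d z → R w z → f q ≠ f u → False := fun hau hdz hwz nqu =>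
      hn ((((((hS.reverse hs).append (hs _ _ hab) (IsSeg.pair hau)).cons (hs _ _ hcd)).cons (hs _ _
        hdz)).cons hwz).hasBiPath ((hT.reverse hb).snoc (hb _ _ hep)) nqu.symm)
  have c13 : R u w → R a u → R d z → R e z → f p ≠ f w → False := fun huw hau hdz hez npw =>
      hn ((((((hS.reverse hs).append (hs _ _ hab) ((IsSeg.pair huw).cons hau)).cons (hs _ _
        hcd)).cons (hs _ _ hdz)).cons hez).hasBiPath hT npw.symm)
  have c14 : B e u → B a u → B a z → B w z → f d ≠ f w → False := fun heu hau haz hwz ndw =>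
      hn ((hS.snoc hcd).hasBiPath (((((hT.cons hep).cons (hb _ _ heu)).cons hau).cons (hb _ _
        haz)).cons hwz) ndw)
  have c15 : B e u → B u w → B w z → B a z → f a ≠ f d → False := fun heu huw hwz haz nad =>
      hn ((hS.snoc hcd).hasBiPath (((((hT.cons hep).cons (hb _ _ heu)).cons (hb _ _ huw)).cons (hb
        _ _ hwz)).cons haz) nad.symm)
  have kb := fin_three_cases hwu hzu hwz (f b)
  have kc := fin_three_cases hwu hzu hwz (f c)
  have kp := fin_three_cases hwu hzu hwz (f p)
  clear hS hT
  have e1 := h.cover a u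
  have e2 := h.cover a z
  have e3 := h.cover d w
  have e4 := h.cover d z
  have e5 := h.cover e u
  have e6 := h.cover e z
  have e7 := h.cover q u
  have e8 := h.cover u w
  have e9 := h.cover w z
  clear hL hn h hs hb
  grind

theorem hasBiPath_of_transversal_of_single_blue (h : TwoColoured f R B)
    {a b c d e u w z : V} {S : List V}
    (hL : ∀ i, 2 * (a :: S ++ [d, e, u, w, z]).countP (f · = i) <
      (a :: S ++ [d, e, u, w, z]).length)
    (hS : IsSeg R b c S) (hab : R a b) (hcd : R c d) (hde : B d e)
    (hdu : f d = f u) (hwu : f w ≠ f u) (hzu : f z ≠ f u) (hwz : f w ≠ f z) (hcu : f c ≠ f u)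
    (haw : f a = f w) (hew : f e = f w) :
    HasBiPath f R B (a :: S ++ [d, e, u, w, z]) := by
  classical
  have hs := h.red_symm
  have hb := h.blue_symm
  have nab := h.red_ne _ _ hab
  have ncd := h.red_ne _ _ hcd
  have nde := h.blue_ne _ _ hde
  by_contra hn
  have c1 : R a z → B d w → f w ≠ f z → f c = f u := fun haz hdw nwz =>
      (IsSeg.ends_eq h hL hn ((hS.reverse hs).append (hs _ _ hab) (IsSeg.pair haz)) ((IsSeg.pair
        hde).cons (hb _ _ hdw)) nwz.symm u).1
  have c2 : B a u → B a z → B w z → f d ≠ f w → f u = f e := fun hau haz hwz ndw =>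
      (IsSeg.ends_eq h hL hn (hS.snoc hcd) (((IsSeg.pair hau).cons (hb _ _ haz)).cons hwz) ndw e).2
  have c3 : R u z → R u w → R d w → f z = f e := fun huz huw hdw =>
      (IsSeg.ends_eq_red h hL hn ((hS.append hcd (((IsSeg.pair huz).cons (hs _ _ huw)).cons
        hdw)).cons hab) e).2
  have c4 : R a u → R d z → R e z → f u = f w := fun hau hdz hez =>
      (IsSeg.ends_eq_red h hL hn (((((hS.reverse hs).append (hs _ _ hab) (IsSeg.pair hau)).cons (hs
        _ _ hcd)).cons (hs _ _ hdz)).cons hez) w).2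
  have c5 : B a u → B a z → B d z → f b ≠ f e → f u = f w := fun hau haz hdz nbe =>
      (IsSeg.ends_eq h hL hn (hS.reverse hs) ((((IsSeg.pair hau).cons (hb _ _ haz)).cons hdz).cons
        (hb _ _ hde)) nbe w).2
  have c6 : R a u → B e z → f u = f w := fun hau hez =>
      (IsSeg.ends_eq h hL hn (((hS.snoc hcd).cons hab).cons (hs _ _ hau)) (IsSeg.pair hez) nde w).1
  have c7 : R a u → B d z → f e ≠ f u → f z = f w := fun hau hdz neu =>
      (IsSeg.ends_eq h hL hn ((hS.reverse hs).append (hs _ _ hab) (IsSeg.pair hau)) ((IsSeg.pair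
        hdz).cons (hb _ _ hde)) neu.symm w).2
  have c8 : R a z → B u w → f w ≠ f z → f d = f e := fun haz huw nwz =>
      (IsSeg.ends_eq h hL hn (((hS.reverse hs).append (hs _ _ hab) (IsSeg.pair haz)).cons (hs _ _
        hcd)) (IsSeg.pair (hb _ _ huw)) nwz.symm e).1
  have c9 : R d z → R w z → B a u → f u = f e := fun hdz hwz hau =>
      (IsSeg.ends_eq h hL hn ((((hS.reverse hs).cons (hs _ _ hcd)).cons (hs _ _ hdz)).cons hwz)
        (IsSeg.pair hau) nab.symm e).2
  have c10 : R d w → B u z → B a u → f z = f e := fun hdw huz hau =>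
      (IsSeg.ends_eq h hL hn (((hS.reverse hs).cons (hs _ _ hcd)).cons (hs _ _ hdw)) ((IsSeg.pair
        huz).cons hau) nab.symm e).2
  have kb := fin_three_cases hwu hzu hwz (f b)
  have kc := fin_three_cases hwu hzu hwz (f c)
  clear hS
  have e1 := h.cover a u
  have e2 := h.cover a z
  have e3 := h.cover d w
  have e4 := h.cover d z
  have e5 := h.cover e z
  have e6 := h.cover u w
  have e7 := h.cover u z
  have e8 := h.cover w z
  clear hL hn h hs hb
  grind

theorem hasBiPath_of_transversal_of_ends (h : TwoColoured f R B)
    {a b c d e g u w z : V} {S T : List V}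
    (hL : ∀ i, 2 * (a :: S ++ [d] ++ T ++ [u, w, z]).countP (f · = i) <
      (a :: S ++ [d] ++ T ++ [u, w, z]).length)
    (hS : IsSeg R b c S) (hT : IsSeg B e g T) (hab : R a b) (hcd : R c d) (hde : B d e)
    (hdu : f d = f u) (hwu : f w ≠ f u) (hzu : f z ≠ f u) (hwz : f w ≠ f z) (hcw : f c = f w)
    (hae : ¬ R a e) (hag : ¬ R a g) (hau : R a u → ¬ R e u)
    (hends : f a = f e → f a = f g → f a = f u) :
    HasBiPath f R B (a :: S ++ [d] ++ T ++ [u, w, z]) := by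
  classical
  have hs := h.red_symm
  have hb := h.blue_symm
  have nab := h.red_ne _ _ hab
  have ncd := h.red_ne _ _ hcd
  have nde := h.blue_ne _ _ hde
  by_contra hn
  have c1 : B a u → B a w → B d w → f b ≠ f g → f c = f z := fun hau haw hdw nbg =>
      (IsSeg.ends_eq h hL hn (hS.reverse hs) ((hT.reverse hb).append (hb _ _ hde) (((IsSeg.pair
        hau).cons (hb _ _ haw)).cons hdw)) nbg z).1
  have c2 : B a w → B a g → B d z → f c ≠ f z → f w = f u := fun haw hag hdz ncz =>
      (IsSeg.ends_eq h hL hn hS (((hT.append (hb _ _ hag) (IsSeg.pair haw)).cons hde).cons (hb _ _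
        hdz)) ncz u).2
  have c3 : B u z → B a u → B a g → f z = f w := fun huz hau hag =>
      (IsSeg.ends_eq h hL hn hS ((hT.append (hb _ _ hag) ((IsSeg.pair huz).cons hau)).cons hde) ncd
        w).2
  have c4 : B d z → B w z → f a ≠ f w → f c = f u := fun hdz hwz naw =>
      (IsSeg.ends_eq h hL hn ((hS.reverse hs).snoc (hs _ _ hab)) (((hT.cons hde).cons (hb _ _
        hdz)).cons hwz) naw u).1
  have c5 : B w z → B a z → B a e → f d ≠ f g → f w = f u := fun hwz haz hae ndg =>
      (IsSeg.ends_eq h hL hn (hS.snoc hcd) ((hT.reverse hb).append (hb _ _ hae) ((IsSeg.pair (hb _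
        _ hwz)).cons haz)) ndg u).2
  have c6 : B a u → B a z → B d z → f b ≠ f g → f u = f w := fun hau haz hdz nbg =>
      (IsSeg.ends_eq h hL hn (hS.reverse hs) ((hT.reverse hb).append (hb _ _ hde) (((IsSeg.pair
        hau).cons (hb _ _ haz)).cons hdz)) nbg w).2
  have c7 : R d w → B a z → B a g → f b ≠ f e → f w = f u := fun hdw haz hag nbe =>
      (IsSeg.ends_eq h hL hn (((hS.reverse hs).cons (hs _ _ hcd)).cons (hs _ _ hdw)) (hT.append (hb
        _ _ hag) (IsSeg.pair haz)) nbe u).1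
  have c8 : R a z → B d w → f w ≠ f z → f c = f u := fun haz hdw nwz =>
      (IsSeg.ends_eq h hL hn ((hS.reverse hs).append (hs _ _ hab) (IsSeg.pair haz)) ((hT.cons
        hde).cons (hb _ _ hdw)) nwz.symm u).1
  have c9 : B u z → B e u → B a g → f d = f w := fun huz heu hag =>
      (IsSeg.ends_eq h hL hn ((hS.reverse hs).cons (hs _ _ hcd)) (((hT.reverse hb).append heu
        (IsSeg.pair huz)).cons hag) nab.symm w).1
  have c10 : R d z → R u z → B a g → f u = f w := fun hdz huz hag =>
      (IsSeg.ends_eq h hL hn ((((hS.reverse hs).cons (hs _ _ hcd)).cons (hs _ _ hdz)).cons huz)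
        ((hT.reverse hb).cons hag) nab.symm w).1
  have c11 : B u z → B d z → f c ≠ f g → f u = f w := fun huz hdz ncg =>
      (IsSeg.ends_eq h hL hn (hS.cons hab) ((hT.reverse hb).append (hb _ _ hde) ((IsSeg.pair (hb _
        _ huz)).cons hdz)) ncg w).2
  have c12 : B a g → B a w → B w z → f d ≠ f z → f e = f u := fun hag haw hwz ndz =>
      (IsSeg.ends_eq h hL hn (hS.snoc hcd) ((((hT.reverse hb).cons hag).cons (hb _ _ haw)).cons (hb
        _ _ hwz)) ndz u).2
  have c13 : R a w → R d z → f g ≠ f w → f z = f u := fun haw hdz ngw =>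
      (IsSeg.ends_eq h hL hn ((((hS.reverse hs).append (hs _ _ hab) (IsSeg.pair haw)).cons (hs _ _
        hcd)).cons (hs _ _ hdz)) (hT.reverse hb) ngw.symm u).1
  have c14 : R d z → R w z → f a ≠ f e → f w = f u := fun hdz hwz nae =>
      (IsSeg.ends_eq h hL hn (((((hS.reverse hs).snoc (hs _ _ hab)).cons (hs _ _ hcd)).cons (hs _ _
        hdz)).cons hwz) hT nae u).1
  have c15 : R d w → R w z → B a e → f z = f u := fun hdw hwz hae =>
      (IsSeg.ends_eq h hL hn ((((hS.reverse hs).cons (hs _ _ hcd)).cons (hs _ _ hdw)).cons (hs _ _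
        hwz)) (hT.cons hae) nab.symm u).1
  have c16 : R a z → R a w → R d w → f g ≠ f z → f e = f u := fun haz haw hdw ngz =>
      (IsSeg.ends_eq h hL hn (hS.append hcd (((IsSeg.pair haz).cons (hs _ _ haw)).cons hdw))
        (hT.reverse hb) ngz.symm u).2
  have c17 : R d w → R a z → f e ≠ f w → f z = f u := fun hdw haz new =>
      (IsSeg.ends_eq h hL hn (((hS.append hcd (IsSeg.pair hdw)).cons hab).cons (hs _ _ haz)) hT
        new.symm u).1
  have c18 : B a z → B a g → B d w → f b ≠ f w → f c = f u := fun haz hag hdw nbw =>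
      (IsSeg.ends_eq h hL hn (hS.reverse hs) (((hT.append (hb _ _ hag) (IsSeg.pair haz)).cons
        hde).cons (hb _ _ hdw)) nbw u).1
  have c19 : R u w → R a u → f e ≠ f w → f d = f z := fun huw hau new =>
      (IsSeg.ends_eq h hL hn (((hS.reverse hs).append (hs _ _ hab) ((IsSeg.pair huw).cons
        hau)).cons (hs _ _ hcd)) hT new.symm z).1
  have c20 : R d z → B a w → B a e → f b ≠ f g → f z = f u := fun hdz haw hae nbg =>
      (IsSeg.ends_eq h hL hn (((hS.reverse hs).cons (hs _ _ hcd)).cons (hs _ _ hdz)) ((hT.reverse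
        hb).append (hb _ _ hae) (IsSeg.pair haw)) nbg u).1
  have c21 : B a w → B a z → B d z → f c ≠ f g → f w = f u := fun haw haz hdz ncg =>
      (IsSeg.ends_eq h hL hn hS ((hT.reverse hb).append (hb _ _ hde) (((IsSeg.pair haw).cons (hb _
        _ haz)).cons hdz)) ncg u).2
  have c22 : R a w → R w z → f z = f u := fun haw hwz =>
      (IsSeg.ends_eq h hL hn (((hS.cons hab).cons (hs _ _ haw)).cons (hs _ _ hwz)) (hT.cons hde)
        ncd u).1
  have c23 : R a u → R u z → R w z → f c ≠ f g → f w = f d := fun hau huz hwz ncg =>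
      (IsSeg.ends_eq h hL hn ((((hS.cons hab).cons (hs _ _ hau)).cons (hs _ _ huz)).cons hwz)
        (hT.reverse hb) ncg d).1
  have c24 : B d w → B u w → f a ≠ f u → f c = f z := fun hdw huw nau =>
      (IsSeg.ends_eq h hL hn ((hS.reverse hs).snoc (hs _ _ hab)) (((hT.cons hde).cons (hb _ _
        hdw)).cons huw) nau z).1
  have c25 : R a u → B w z → B d z → f c ≠ f g → False := fun hau hwz hdz ncg =>
      hn (((hS.cons hab).cons (hs _ _ hau)).hasBiPath ((hT.reverse hb).append (hb _ _ hde)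
        ((IsSeg.pair (hb _ _ hwz)).cons hdz)) ncg)
  have c26 : R u z → R a z → f e ≠ f u → f g = f w := fun huz haz neu =>
      (IsSeg.ends_eq h hL hn (((hS.reverse hs).append (hs _ _ hab) ((IsSeg.pair (hs _ _ huz)).cons
        haz)).cons (hs _ _ hcd)) hT neu.symm w).2
  have ka := fin_three_cases hwu hzu hwz (f a)
  have kb := fin_three_cases hwu hzu hwz (f b)
  have ke := fin_three_cases hwu hzu hwz (f e)
  have kg := fin_three_cases hwu hzu hwz (f g)
  clear hS hT
  have e1 := h.cover a e
  have e2 := h.cover a g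
  have e3 := h.cover a u
  have e4 := h.cover a w
  have e5 := h.cover a z
  have e6 := h.cover d w
  have e7 := h.cover d z
  have e8 := h.cover e u
  have e9 := h.cover u w
  have e10 := h.cover u z
  have e11 := h.cover w z
  clear hL hn h hs hb
  grind

/-- A red path followed by a blue path, missing exactly one vertex of each class of `L`. -/
def TransversalBiPath {V : Type*} (f : V → Fin 3) (R B : V → V → Prop) (L P Q : List V) : Prop :=
  BiPath f R B P Q ∧ ∃ x y z, f x ≠ f y ∧ f x ≠ f z ∧ f y ≠ f z ∧ (P ++ Q ++ [x, y, z]).Perm L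

theorem TransversalBiPath.swap (h : TwoColoured f R B) {L P Q : List V}
    (hPQ : TransversalBiPath f R B L P Q) : TransversalBiPath f B R L Q.reverse P.reverse := by
  obtain ⟨h1, x, y, z, hxy, hxz, hyz, hp⟩ := hPQ
  refine ⟨h1.swap h, x, y, z, hxy, hxz, hyz, List.Perm.trans ?_ hp⟩
  rw [← List.reverse_append]
  exact (List.reverse_perm _).append_right _

theorem exists_perm_transversal {x y z : V} {i j : Fin 3} (hxy : f x ≠ f y) (hxz : f x ≠ f z)
    (hyz : f y ≠ f z) (hij : i ≠ j) :
    ∃ u w t, f u = i ∧ f w = j ∧ f t ≠ i ∧ f t ≠ j ∧ [u, w, t].Perm [x, y, z] := by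
  classical
  have ki := fin_three_cases hxz hyz hxy i
  have kj := fin_three_cases hxz hyz hxy j
  have key : ∀ u w t : V, f u = i → f w = j → f t ≠ i → f t ≠ j →
      (∀ v, [u, w, t].count v = [x, y, z].count v) → _ :=
    fun u w t h1 h2 h3 h4 h5 => (⟨u, w, t, h1, h2, h3, h4, List.perm_iff_count.2 h5⟩ :
      ∃ u w t, f u = i ∧ f w = j ∧ f t ≠ i ∧ f t ≠ j ∧ [u, w, t].Perm [x, y, z])
  rcases ki with rfl | rfl | rfl <;> rcases kj with rfl | rfl | rfl
  · exact absurd rfl hij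
  · exact key z x y rfl rfl hyz hxy.symm (by grind)
  · exact key z y x rfl rfl hxz hxy (by grind)
  · exact key x z y rfl rfl hxy.symm hyz (by grind)
  · exact absurd rfl hij
  · exact key x y z rfl rfl hxz.symm hyz.symm (by grind)
  · exact key y z x rfl rfl hxy hxz (by grind)
  · exact key y x z rfl rfl hyz.symm hxz.symm (by grind)
  · exact absurd rfl hij

theorem length_eq_sum_countP (f : V → Fin 3) (L : List V) :
    L.length = L.countP (f · = 0) + L.countP (f · = 1) + L.countP (f · = 2) := by
  induction L with
  | nil => rfl
  | cons a L ih =>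
    have : f a = 0 ∨ f a = 1 ∨ f a = 2 := by generalize f a = i; revert i; decide
    rcases this with h | h | h <;> simp [h, ih] <;> omega

theorem hasBiPath_of_maximal_transversal (h : TwoColoured f R B) {L P Q : List V}
    (hL : ∀ i, 2 * L.countP (f · = i) < L.length) (h2 : ∀ i, 2 ≤ L.countP (f · = i))
    (hPQ : TransversalBiPath f R B L P Q)
    (hmax : ∀ P' Q', TransversalBiPath f R B L P' Q' → P'.length ≤ P.length)
    (hmax' : ∀ P' Q', TransversalBiPath f B R L P' Q' → P'.length ≤ P.length) :
    HasBiPath f R B L := by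
  classical
  have hs := h.red_symm
  have hb := h.blue_symm
  have hQP := hmax' _ _ (hPQ.swap h)
  obtain ⟨hPQ, x, y, z, hxy, hxz, hyz, hp⟩ := hPQ
  have hlen := hp.length_eq
  have hsum := length_eq_sum_countP f L
  have h20 := h2 0
  have h21 := h2 1
  have h22 := h2 2
  simp only [List.length_append, List.length_cons, List.length_nil, List.length_reverse] at hlen hQP
  obtain ⟨a, d, hP⟩ := IsSeg.exists_of_ne_nil hPQ.1 (List.ne_nil_of_length_pos (by omega))
  rcases hP.unsnoc with ⟨rfl, rfl⟩ | ⟨c, P, rfl, hP', hcd⟩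
  · simp at *; omega
  have hde : ∀ e ∈ Q.head?, B d e := by
    intro e he
    refine (h.cover d e (hPQ.2.2 d hP.last e he)).resolve_left fun hr => ?_
    obtain ⟨Q, rfl⟩ : ∃ Q', Q = e :: Q' := by cases Q <;> simp_all
    have := hmax (P ++ [d] ++ [e]) Q ⟨⟨(hP.snoc hr).chain, hPQ.2.1.tail, ?_⟩, x, y, z, hxy, hxz,
      hyz, by simpa using hp⟩
    · simp at this
    · intro a ha b hb'
      have := hPQ.2.1
      rw [List.isChain_cons] at this
      simp only [List.getLast?_append, List.getLast?_singleton] at ha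
      simp at ha
      subst ha
      exact h.blue_ne _ _ (this.1 b hb')
  have hlong : Q.length ≤ P.length := by
    have := hmax' (d :: Q).reverse P.reverse ⟨⟨?_, ?_, ?_⟩, x, y, z, hxy, hxz, hyz, ?_⟩
    · simpa using this
    · exact isChain_reverse_of_symm hb (List.isChain_cons.2 ⟨hde, hPQ.2.1⟩)
    · exact isChain_reverse_of_symm hs hP'.chain
    · simp [hP'.last]
      exact (h.red_ne _ _ hcd).symm
    · refine List.Perm.trans (List.perm_iff_count.2 ?_) hp
      intro v
      simp only [List.count_append, List.count_cons, List.count_nil, List.count_reverse]; omega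
  simp only [List.length_append, List.length_cons, List.length_nil] at hlen hQP
  rcases hP'.uncons with ⟨rfl, rfl⟩ | ⟨b, S, rfl, hab, hS⟩
  · obtain ⟨e, rfl⟩ : ∃ e, Q = [e] := by
      rw [← List.length_eq_one_iff]; simp at *; omega
    have hde : B d e := by simpa using hde
    have hae : f a ≠ f e := by
      intro hae
      have h3 := hL (f a)
      rw [← hp.countP_eq, ← hp.length_eq] at h3
      rcases fin_three_cases hxz hyz hxy (f a) with h4 | h4 | h4 <;>
        simp [List.countP_cons, ← hae, ← h4] at h3 <;> omega
    rcases h.cover a e hae with hae | hae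
    · have := hmax [d, a, e] [] ⟨⟨?_, by simp, by simp⟩, x, y, z, hxy, hxz, hyz, ?_⟩
      · simp at this
      · simpa using ⟨hs _ _ hcd, hae⟩
      · refine List.Perm.trans (List.perm_iff_count.2 ?_) hp
        intro v
        simp only [List.count_append, List.count_cons, List.count_nil]; omega
    · have := hmax' [a, e, d] [] ⟨⟨?_, by simp, by simp⟩, x, y, z, hxy, hxz, hyz, ?_⟩
      · simp at this
      · simpa using ⟨hae, hb _ _ hde⟩
      · refine List.Perm.trans (List.perm_iff_count.2 ?_) hp
        intro v
        simp only [List.count_append, List.count_cons, List.count_nil]; omega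
  have transfer : ∀ {L' : List V} {u w t : V}, [u, w, t].Perm [x, y, z] →
      (∀ v, L'.count v = (a :: S ++ [d] ++ Q ++ [u, w, t]).count v) →
      ((∀ i, 2 * L'.countP (f · = i) < L'.length) → HasBiPath f R B L') → HasBiPath f R B L := by
    intro L' u w t h1 h3 h4
    have hp' : L'.Perm L :=
      (List.perm_iff_count.2 h3).trans ((h1.append_left _).trans (by simpa using hp))
    refine (h4 fun i => ?_).perm hp'
    rw [hp'.countP_eq, hp'.length_eq]
    exact hL i
  have ncd := h.red_ne _ _ hcd
  obtain ⟨u, w, t, hu, hw, htu, htw, hperm⟩ := exists_perm_transversal hxy hxz hyz ncd.symm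
  rcases eq_or_ne Q [] with rfl | hQ
  · refine transfer hperm (L' := a :: S ++ [d, u, w, t]) ?_ fun hL' =>
      hasBiPath_of_transversal_of_red h hL' hS hab hcd hu.symm ?_ ?_ ?_ hw.symm
    · intro v
      simp only [List.count_append, List.count_cons, List.count_nil]; omega
    all_goals grind
  obtain ⟨e, g, hQ⟩ := IsSeg.exists_of_ne_nil hPQ.2.1 hQ
  have hde' : B d e := hde e hQ.head
  have nde := h.blue_ne _ _ hde'
  obtain ⟨Q₁, rfl, hQ₁, hQ₁e⟩ : ∃ Q', Q = e :: Q' ∧ Q'.IsChain B ∧ ∀ y ∈ Q'.head?, f e ≠ f y := by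
    rcases hQ.uncons with ⟨rfl, rfl⟩ | ⟨p, Q', rfl, hep, hQ'⟩
    · exact ⟨[], rfl, by simp, by simp⟩
    · exact ⟨Q', rfl, hQ'.chain, by simpa [hQ'.head] using h.blue_ne _ _ hep⟩
  have too_long : ∀ {p p' r s r' : V} {P' Q' : List V}, IsSeg R p p' P' → Q'.IsChain B →
      (∀ y ∈ Q'.head?, f p' ≠ f y) → f r ≠ f s → f r ≠ f r' → f s ≠ f r' →
      (∀ v, (P' ++ Q' ++ [r, s, r']).count v = (a :: S ++ [d] ++ e :: Q₁ ++ [u, w, t]).count v) →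
      ¬ (a :: S ++ [d]).length < P'.length := by
    intro p p' r s r' P' Q' hP' hQ' hj h1 h2 h3 h4
    refine not_lt.2 (hmax P' Q' ⟨⟨hP'.chain, hQ', ?_⟩, r, s, r', h1, h2, h3, ?_⟩)
    · simpa [hP'.last] using hj
    · exact (List.perm_iff_count.2 h4).trans ((hperm.append_left _).trans (by simpa using hp))
  by_cases hends : f a = f e → f a = f g → f a = f u
  · refine transfer hperm (L' := a :: S ++ [d] ++ e :: Q₁ ++ [u, w, t]) (fun _ => rfl) fun hL' =>
      hasBiPath_of_transversal_of_ends h hL' hS hQ hab hcd hde' hu.symm ?_ ?_ ?_ hw.symm ?_ ?_ ?_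
        hends
    · grind
    · grind
    · grind
    · intro hae
      refine too_long (r := u) (s := w) (r' := t) ((hP.reverse hs).snoc hae) hQ₁ hQ₁e
        (by grind) (by grind) (by grind) ?_ (by simp)
      intro v
      simp only [List.count_append, List.count_cons, List.count_nil, List.count_reverse]; omega
    · intro hag
      obtain ⟨Q₂, hQ₂, hQ₂c, hQ₂g⟩ : ∃ Q', e :: Q₁ = Q' ++ [g] ∧ Q'.IsChain B ∧
          ∀ y ∈ Q'.getLast?, f g ≠ f y := by
        rcases hQ.unsnoc with ⟨h1, rfl⟩ | ⟨p, Q', h1, hQ', hpg⟩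
        · exact ⟨[], h1, by simp, by simp⟩
        · exact ⟨Q', h1, hQ'.chain, by simpa [hQ'.last] using (h.blue_ne _ _ hpg).symm⟩
      refine too_long (r := u) (s := w) (r' := t) ((hP.reverse hs).snoc hag)
        (isChain_reverse_of_symm hb hQ₂c) (by simpa using hQ₂g) (by grind) (by grind) (by grind) ?_
        (by simp)
      intro v
      rw [hQ₂]
      simp only [List.count_append, List.count_cons, List.count_nil, List.count_reverse]; omega
    · intro hau heu
      refine too_long (r := d) (s := w) (r' := t)
        (((hS.reverse hs).append (hs _ _ hab) (IsSeg.pair hau)).snoc (hs _ _ heu)) hQ₁ hQ₁e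
        (by grind) (by grind) (by grind) ?_ (by simp)
      intro v
      simp only [List.count_append, List.count_cons, List.count_nil, List.count_reverse]; omega
  · push Not at hends
    obtain ⟨hae, hag, hau⟩ := hends
    obtain ⟨u', w', t', hu', hw', htu', htw', hperm'⟩ :=
      exists_perm_transversal hxy hxz hyz (hu.symm.trans_ne hau.symm)
    rcases hQ.uncons with ⟨h1, rfl⟩ | ⟨p, Q', h1, hep, hQ'⟩
    · obtain rfl : Q₁ = [] := by simpa using h1
      refine transfer hperm' (L' := a :: S ++ [d, e, u', w', t']) ?_ fun hL' =>
        hasBiPath_of_transversal_of_single_blue h hL' hS hab hcd hde' ?_ ?_ ?_ ?_ ?_ ?_ ?_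
      · intro v
        simp only [List.count_append, List.count_cons, List.count_nil]; omega
      all_goals grind
    · obtain rfl : Q₁ = Q' := by simpa using h1
      refine transfer hperm' (L' := a :: S ++ [d] ++ e :: Q₁ ++ [u', w', t']) (fun _ => rfl)
        fun hL' => hasBiPath_of_transversal_of_long_blue h hL' hS hQ' hab hcd hde' hep
          ?_ ?_ ?_ ?_ ?_ ?_ ?_ ?_
      all_goals grind

theorem hasBiPath_of_transversalBiPath (h : TwoColoured f R B) {L P Q : List V}
    (hL : ∀ i, 2 * L.countP (f · = i) < L.length) (h2 : ∀ i, 2 ≤ L.countP (f · = i))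
    (hPQ : TransversalBiPath f R B L P Q) : HasBiPath f R B L := by
  classical
  let p : ℕ → Prop := fun n => ∃ P Q, (TransversalBiPath f R B L P Q ∨
    TransversalBiPath f B R L P Q) ∧ P.length = n
  have hbound : ∀ {R B : V → V → Prop} {P Q}, TransversalBiPath f R B L P Q →
      P.length ≤ L.length := by
    rintro R B P Q ⟨-, x, y, z, -, -, -, hp⟩
    have := hp.length_eq
    simp only [List.length_append] at this
    omega
  have hp0 : p P.length := ⟨P, Q, Or.inl hPQ, rfl⟩
  obtain ⟨P', Q', hPQ', hlen⟩ : p (Nat.findGreatest p L.length) :=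
    Nat.findGreatest_spec (hbound hPQ) hp0
  have hmax : ∀ P₁ Q₁, TransversalBiPath f R B L P₁ Q₁ ∨ TransversalBiPath f B R L P₁ Q₁ →
      P₁.length ≤ P'.length := by
    intro P₁ Q₁ h1
    rw [hlen]
    exact Nat.le_findGreatest (h1.elim hbound hbound) ⟨P₁, Q₁, h1, rfl⟩
  rcases hPQ' with h1 | h1
  · exact hasBiPath_of_maximal_transversal h hL h2 h1 (fun P₁ Q₁ h2 => hmax _ _ (Or.inl h2))
      fun P₁ Q₁ h2 => hmax _ _ (Or.inr h2)
  · exact (hasBiPath_of_maximal_transversal h.swap hL h2 h1 (fun P₁ Q₁ h2 => hmax _ _ (Or.inr h2))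
      fun P₁ Q₁ h2 => hmax _ _ (Or.inl h2)).swap h.swap

theorem IsSeg.join {r : V → V → Prop} {x y z : V} {S T : List V} (hS : IsSeg r x y (S ++ [y]))
    (hT : IsSeg r y z (y :: T)) : IsSeg r x z (S ++ y :: T) := by
  rcases hT.uncons with ⟨h, rfl⟩ | ⟨w, m, h, hyw, hm⟩
  · simpa [h] using hS
  · obtain rfl : T = m := by simpa using h
    simpa using hS.append hyw hm

theorem exists_append_perm {D : List V} {n : ℕ} (x : V) (hn : 1 ≤ n) (h : n ≤ D.length) :
    ∃ D₀ D₁ : List V, (D₀ ++ D₁).Perm D ∧ D₀.length = n ∧ (x ∈ D → x ∈ D₀) := by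
  classical
  by_cases hx : x ∈ D
  · have hp := List.perm_cons_erase hx
    have hlen := hp.length_eq
    rw [List.length_cons] at hlen
    refine ⟨x :: (D.erase x).take (n - 1), (D.erase x).drop (n - 1), ?_, ?_, by simp⟩
    · simpa using hp.symm
    · rw [List.length_cons, List.length_take]; omega
  · exact ⟨D.take n, D.drop n, by simp, by simpa using h, fun h => absurd h hx⟩

/-- A balanced complete bipartite graph has a Hamilton path between any two vertices of different
sides. -/
theorem exists_isSeg_of_complete {r : V → V → Prop} (hr : ∀ x y, r x y → r y x) :
    ∀ {A D : List V} {a d : V}, A.length = D.length → (∀ x ∈ a :: A, ∀ y ∈ d :: D, r x y) →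
      ∃ l, IsSeg r a d l ∧ l.Perm (a :: A ++ d :: D)
  | [], [], a, d, _, h => ⟨[a, d], IsSeg.pair (h a (by simp) d (by simp)), by simp⟩
  | a' :: A, d' :: D, a, d, hl, h => by
    classical
    obtain ⟨l, hl, hp⟩ := exists_isSeg_of_complete (a := a') (d := d) hr (A := A) (D := D)
      (by simpa using hl) fun x hx y hy => h x (by simp_all) y (by grind)
    refine ⟨_, (hl.cons (hr _ _ (h a' (by simp) d' (by simp)))).cons
      (h a (by simp) d' (by simp)), ?_⟩
    rw [List.perm_iff_count] at hp ⊢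
    intro v
    have := hp v
    simp only [List.count_append, List.count_cons] at this ⊢
    omega

theorem exists_isSeg_of_mem {r : V → V → Prop} (hr : ∀ x y, r x y → r y x) {A D : List V} {a d : V}
    (ha : a ∈ A) (hd : d ∈ D) (hl : A.length = D.length) (h : ∀ x ∈ A, ∀ y ∈ D, r x y) :
    ∃ l, IsSeg r a d l ∧ l.Perm (A ++ D) := by
  classical
  have hA := List.perm_cons_erase ha
  have hD := List.perm_cons_erase hd
  have hA' := hA.length_eq
  have hD' := hD.length_eq
  obtain ⟨l, h1, h2⟩ := exists_isSeg_of_complete hr (A := A.erase a) (D := D.erase d) (a := a)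
    (d := d) (by simp only [List.length_cons] at hA' hD'; omega)
    fun x hx y hy => h x (hA.mem_iff.2 hx) y (hD.mem_iff.2 hy)
  exact ⟨l, h1, h2.trans (hA.symm.append hD.symm)⟩

theorem exists_isSeg_to {r : V → V → Prop} (hr : ∀ x y, r x y → r y x) {A D : List V} {x : V}
    (hx : x ∈ A ∨ x ∈ D) (hl : A.length = D.length) (h : ∀ x ∈ A, ∀ y ∈ D, r x y) :
    ∃ s l, IsSeg r s x l ∧ l.Perm (A ++ D) ∧ (x ∈ A ∧ s ∈ D ∨ x ∈ D ∧ s ∈ A) := by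
  rcases hx with hx | hx
  · obtain ⟨d, hd⟩ := List.exists_mem_of_length_pos (l := D) (hl ▸ List.length_pos_of_mem hx)
    obtain ⟨l, h1, h2⟩ := exists_isSeg_of_mem hr hx hd hl h
    exact ⟨d, _, h1.reverse hr, (List.reverse_perm _).trans h2, Or.inl ⟨hx, hd⟩⟩
  · obtain ⟨a, ha⟩ := List.exists_mem_of_length_pos (l := A) (hl ▸ List.length_pos_of_mem hx)
    obtain ⟨l, h1, h2⟩ := exists_isSeg_of_mem hr ha hx hl h
    exact ⟨a, _, h1, h2, Or.inr ⟨hx, ha⟩⟩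

theorem hasBiPath_of_split_of_length_le (h : TwoColoured f R B) {A A' D D' m : List V} {x y : V}
    (hAD : ∀ a ∈ A, ∀ d ∈ D, R a d) (hAD' : ∀ a ∈ A', ∀ d ∈ D', R a d)
    (hblue : ∀ a ∈ A', ∀ d ∈ D, B a d) (hlen : A.length + A'.length = D.length + D'.length)
    (hle : A.length ≤ D.length) (hA : A ≠ []) (hD : D' ≠ []) (hx : x ∈ A ∨ x ∈ D)
    (hy : y ∈ A' ∨ y ∈ D') (hm : IsSeg R x y (x :: m ++ [y])) :
    HasBiPath f R B (A ++ A' ++ D ++ D' ++ m) := by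
  classical
  obtain ⟨D₀, D₁, hDp, hD₀, hxD⟩ := exists_append_perm x (List.length_pos_iff.2 hA) hle
  obtain ⟨A₀, A₁, hAp, hA₀, hyA⟩ := exists_append_perm (D := A') y (List.length_pos_iff.2 hD)
    (by omega)
  have hDl := hDp.length_eq
  have hAl := hAp.length_eq
  rw [List.length_append] at hDl hAl
  obtain ⟨s, S, hS, hSp, hs⟩ := exists_isSeg_to h.red_symm (A := A) (D := D₀) (x := x)
    (hx.imp_right hxD) hD₀.symm fun a ha d hd => hAD a ha d (hDp.subset (by simp [hd]))
  obtain ⟨t, T, hT, hTp, ht⟩ := exists_isSeg_to h.red_symm (A := A₀) (D := D') (x := y)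
    (hy.imp_left hyA) hA₀ fun a ha d hd => hAD' a (hAp.subset (by simp [ha])) d hd
  have hT := hT.reverse h.red_symm
  obtain ⟨S, rfl⟩ := hS.exists_snoc
  obtain ⟨T', hT'⟩ := hT.exists_cons
  have hP : IsSeg R s t (S ++ (x :: m ++ [y]) ++ T') := by
    have h1 : IsSeg R s y ((S ++ x :: m) ++ [y]) := by simpa using hS.join (by simpa using hm)
    simpa using h1.join (hT' ▸ hT)
  obtain ⟨Q, hQ, hQp, hj⟩ : ∃ Q : List V, Q.IsChain B ∧ Q.Perm (A₁ ++ D₁) ∧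
      ∀ q ∈ Q.head?, f t ≠ f q := by
    rcases eq_or_ne A₁ [] with rfl | hA₁
    · obtain rfl : D₁ = [] := List.length_eq_zero_iff.1 (by simp at hAl; omega)
      exact ⟨[], by simp, by simp, by simp⟩
    obtain ⟨a, ha⟩ := List.exists_mem_of_ne_nil _ hA₁
    obtain ⟨d, hd⟩ := List.exists_mem_of_length_pos (l := D₁)
      (by have := List.length_pos_of_mem ha; omega)
    obtain ⟨l, hl, hlp⟩ := exists_isSeg_of_mem h.blue_symm ha hd (by omega)
      fun a ha d hd => hblue a (hAp.subset (by simp [ha])) d (hDp.subset (by simp [hd]))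
    rcases ht with ⟨-, ht⟩ | ⟨-, ht⟩
    · refine ⟨l, hl.chain, hlp, ?_⟩
      simpa [hl.head] using (h.red_ne _ _ (hAD' a (hAp.subset (by simp [ha])) t ht)).symm
    · refine ⟨l.reverse, (hl.reverse h.blue_symm).chain, (List.reverse_perm _).trans hlp, ?_⟩
      simpa [hl.last] using
        h.blue_ne _ _ (hblue t (hAp.subset (by simp [ht])) d (hDp.subset (by simp [hd])))
  refine ⟨_, Q, ⟨hP.chain, hQ, by rw [hP.last]; simpa using hj⟩, ?_⟩
  rw [List.perm_iff_count] at *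
  intro v
  have e1 := hDp v
  have e2 := hAp v
  have e3 := hSp v
  have e4 := hTp v
  have e5 := hQp v
  have e6 := congrArg (List.count v) hT'
  simp only [List.count_append, List.count_cons, List.count_nil, List.count_reverse] at *
  omega

/-- A split colouring of a balanced complete bipartite graph together with a red connection between
the two red components. -/
theorem hasBiPath_of_split (h : TwoColoured f R B) {A A' D D' m : List V} {x y : V}
    (hAD : ∀ a ∈ A, ∀ d ∈ D, R a d) (hAD' : ∀ a ∈ A', ∀ d ∈ D', R a d)
    (hb : ∀ a ∈ A', ∀ d ∈ D, B a d) (hb' : ∀ a ∈ A, ∀ d ∈ D', B a d)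
    (hlen : A.length + A'.length = D.length + D'.length) (hA : A ≠ []) (hA' : A' ≠ [])
    (hD : D ≠ []) (hD' : D' ≠ []) (hx : x ∈ A ∨ x ∈ D) (hy : y ∈ A' ∨ y ∈ D')
    (hm : IsSeg R x y (x :: m ++ [y])) : HasBiPath f R B (A ++ A' ++ D ++ D' ++ m) := by
  classical
  rcases le_total A.length D.length with hle | hle
  · exact hasBiPath_of_split_of_length_le h hAD hAD' hb hlen hle hA hD' hx hy hm
  · exact (hasBiPath_of_split_of_length_le h (A := D) (A' := D') (D := A) (D' := A')
      (fun a ha d hd => h.red_symm _ _ (hAD d hd a ha))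
      (fun a ha d hd => h.red_symm _ _ (hAD' d hd a ha))
      (fun a ha d hd => h.blue_symm _ _ (hb' d hd a ha)) hlen.symm hle hD hA' hx.symm hy.symm
      hm).of_count

/-- The vertices of `L`, all in the classes `i` and `j`, split into two complete red bipartite
graphs between which all edges are blue. -/
def HasSplit {V : Type*} (f : V → Fin 3) (R B : V → V → Prop) (i j : Fin 3) (L : List V) : Prop :=
  ∃ A A' D D' : List V, (A ++ A' ++ D ++ D').Perm L ∧ A ≠ [] ∧ A' ≠ [] ∧ D ≠ [] ∧ D' ≠ [] ∧
    (∀ a ∈ A, f a = i) ∧ (∀ a ∈ A', f a = i) ∧ (∀ d ∈ D, f d = j) ∧ (∀ d ∈ D', f d = j) ∧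
    (∀ a ∈ A, ∀ d ∈ D, R a d) ∧ (∀ a ∈ A', ∀ d ∈ D', R a d) ∧
    (∀ a ∈ A', ∀ d ∈ D, B a d) ∧ ∀ a ∈ A, ∀ d ∈ D', B a d

/-- A red path `P` together with two balanced complete blue bipartite graphs. -/
structure Blocks {V : Type*} (f : V → Fin 3) (R B : V → V → Prop) (i j : Fin 3)
    (L P A₁ B₁ A₂ B₂ : List V) : Prop where
  perm : (P ++ A₁ ++ B₁ ++ A₂ ++ B₂).Perm L
  chain : P.IsChain R
  fst₁ : ∀ a ∈ A₁, f a = i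
  snd₁ : ∀ b ∈ B₁, f b = j
  fst₂ : ∀ a ∈ A₂, f a = i
  snd₂ : ∀ b ∈ B₂, f b = j
  len₁ : A₁.length = B₁.length
  len₂ : A₂.length = B₂.length
  blue₁ : ∀ a ∈ A₁, ∀ b ∈ B₁, B a b
  blue₂ : ∀ a ∈ A₂, ∀ b ∈ B₂, B a b

namespace Blocks

variable {i j : Fin 3} {L P A₁ B₁ A₂ B₂ : List V}

theorem symm (hB : Blocks f R B i j L P A₁ B₁ A₂ B₂) : Blocks f R B i j L P A₂ B₂ A₁ B₁ := by
  classical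
  obtain ⟨h1, h2, h3, h4, h5, h6, h7, h8, h9, h10⟩ := hB
  refine ⟨List.Perm.trans (List.perm_iff_count.2 fun v => ?_) h1, h2, h5, h6, h3, h4, h8, h7, h10,
    h9⟩
  simp only [List.count_append]; omega

theorem flip (h : TwoColoured f R B) (hB : Blocks f R B i j L P A₁ B₁ A₂ B₂) :
    Blocks f R B j i L P.reverse B₁ A₁ B₂ A₂ := by
  classical
  obtain ⟨h1, h2, h3, h4, h5, h6, h7, h8, h9, h10⟩ := hB
  refine ⟨List.Perm.trans (List.perm_iff_count.2 fun v => ?_) h1,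
    isChain_reverse_of_symm h.red_symm h2, h4, h3, h6, h5, h7.symm, h8.symm,
    fun b hb a ha => h.blue_symm _ _ (h9 a ha b hb),
    fun b hb a ha => h.blue_symm _ _ (h10 a ha b hb)⟩
  simp only [List.count_append, List.count_reverse]; omega

theorem hasBiPath_of_seg (hB : Blocks f R B i j L P A₁ B₁ A₂ B₂) (h : TwoColoured f R B)
    (hij : i ≠ j) (hL : ∀ x ∈ L, f x = i ∨ f x = j) {Q : List V} {s t : V} (hQ : IsSeg B s t Q)
    (hs : f s = i) (ht : f t = j) (hp : Q.Perm (A₁ ++ B₁ ++ A₂ ++ B₂)) : HasBiPath f R B L := by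
  have hlast : ∀ x ∈ P.getLast?, f x = i ∨ f x = j := fun x hx =>
    hL x (hB.perm.subset (by simp [List.mem_of_getLast? hx]))
  have hp' := (hp.append_left P).trans (by simpa using hB.perm)
  by_cases hi : ∃ x ∈ P.getLast?, f x = i
  · refine ⟨P, Q.reverse, ⟨hB.chain, isChain_reverse_of_symm h.blue_symm hQ.chain, ?_⟩,
      ((List.reverse_perm Q).append_left P).trans hp'⟩
    obtain ⟨x, hx, hxi⟩ := hi
    intro x' hx' y hy
    rw [Option.mem_unique hx' hx]
    simp [hQ.last] at hy
    grind
  · refine ⟨P, Q, ⟨hB.chain, hQ.chain, ?_⟩, hp'⟩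
    intro x hx y hy
    rw [hQ.head] at hy
    have := hlast x hx
    simp at hy hi
    grind

theorem hasBiPath_of_eq_nil (hB : Blocks f R B i j L P A₁ B₁ A₂ B₂) (h : TwoColoured f R B)
    (hij : i ≠ j) (hL : ∀ x ∈ L, f x = i ∨ f x = j) (hA : A₁ = []) : HasBiPath f R B L := by
  subst hA
  obtain rfl : B₁ = [] := List.length_eq_zero_iff.1 hB.len₁.symm
  rcases eq_or_ne A₂ [] with rfl | hA
  · obtain rfl : B₂ = [] := List.length_eq_zero_iff.1 hB.len₂.symm
    exact ⟨P, [], ⟨hB.chain, by simp, by simp⟩, by simpa using hB.perm⟩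
  · obtain ⟨a, ha⟩ := List.exists_mem_of_ne_nil _ hA
    obtain ⟨b, hb⟩ := List.exists_mem_of_length_pos (l := B₂)
      (hB.len₂ ▸ List.length_pos_of_mem ha)
    obtain ⟨Q, hQ, hp⟩ := exists_isSeg_of_mem h.blue_symm ha hb hB.len₂ hB.blue₂
    exact hB.hasBiPath_of_seg h hij hL hQ (hB.fst₂ a ha) (hB.snd₂ b hb) (by simpa using hp)

theorem hasBiPath_of_blue (hB : Blocks f R B i j L P A₁ B₁ A₂ B₂) (h : TwoColoured f R B)
    (hij : i ≠ j) (hL : ∀ x ∈ L, f x = i ∨ f x = j) {a b : V} (ha : a ∈ A₁) (hb : b ∈ B₂)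
    (hab : B a b) : HasBiPath f R B L := by
  classical
  obtain ⟨b', hb'⟩ := List.exists_mem_of_length_pos (l := B₁)
    (hB.len₁ ▸ List.length_pos_of_mem ha)
  obtain ⟨a', ha'⟩ := List.exists_mem_of_length_pos (l := A₂)
    (hB.len₂ ▸ List.length_pos_of_mem hb)
  obtain ⟨Q₁, hQ₁, hp₁⟩ := exists_isSeg_of_mem h.blue_symm ha hb' hB.len₁ hB.blue₁
  obtain ⟨Q₂, hQ₂, hp₂⟩ := exists_isSeg_of_mem h.blue_symm ha' hb hB.len₂ hB.blue₂
  refine hB.hasBiPath_of_seg h hij hL (hQ₂.append (h.blue_symm _ _ hab) hQ₁) (hB.fst₂ _ ha')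
    (hB.snd₁ _ hb') ?_
  rw [List.perm_iff_count] at *
  intro v
  have e1 := hp₁ v
  have e2 := hp₂ v
  simp only [List.count_append] at *
  omega

theorem hasBiPath_of_end {p p' : V} (hB : Blocks f R B i j L P A₁ B₁ A₂ B₂)
    (h : TwoColoured f R B) (hij : i ≠ j) (hP : IsSeg R p p' P) (hp : f p = i) (hp' : f p' = j)
    {b₁ b₂ : V} (hb₁ : b₁ ∈ B₁) (hb₂ : b₂ ∈ B₂) (hpb₁ : B p b₁) (hpb₂ : B p b₂) :
    HasBiPath f R B L := by
  classical
  obtain ⟨a₁, ha₁⟩ := List.exists_mem_of_length_pos (l := A₁)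
    (hB.len₁ ▸ List.length_pos_of_mem hb₁)
  obtain ⟨a₂, ha₂⟩ := List.exists_mem_of_length_pos (l := A₂)
    (hB.len₂ ▸ List.length_pos_of_mem hb₂)
  obtain ⟨Q₁, hQ₁, hp₁⟩ := exists_isSeg_of_mem h.blue_symm ha₁ hb₁ hB.len₁ hB.blue₁
  obtain ⟨Q₂, hQ₂, hp₂⟩ := exists_isSeg_of_mem h.blue_symm ha₂ hb₂ hB.len₂ hB.blue₂
  rcases hP.uncons with ⟨-, rfl⟩ | ⟨q, P', rfl, -, hP'⟩
  · exact absurd (hp.symm.trans hp') hij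
  refine (hP'.hasBiPath (hQ₁.append (h.blue_symm _ _ hpb₁) ((hQ₂.reverse h.blue_symm).cons hpb₂))
    ?_ (fun v => rfl)).perm (List.Perm.trans ?_ hB.perm)
  · rw [hp', hB.fst₁ _ ha₁]; exact hij.symm
  · rw [List.perm_iff_count] at *
    intro v
    have e1 := hp₁ v
    have e2 := hp₂ v
    simp only [List.count_append, List.count_cons, List.count_reverse] at *
    omega

end Blocks

theorem IsSeg.countP_eq {r : V → V → Prop} (hr : ∀ x y, r x y → f x ≠ f y) {i j : Fin 3}
    (hij : i ≠ j) : ∀ {l : List V} {x y : V}, IsSeg r x y l → (∀ z ∈ l, f z = i ∨ f z = j) →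
    (f x = i → f y = i → l.countP (f · = i) = l.countP (f · = j) + 1) ∧
    (f x = i → f y = j → l.countP (f · = i) = l.countP (f · = j)) ∧
    (f x = j → f y = i → l.countP (f · = i) = l.countP (f · = j)) ∧
    (f x = j → f y = j → l.countP (f · = i) + 1 = l.countP (f · = j))
  | l, x, y, hl, hz => by
    rcases hl.uncons with ⟨rfl, rfl⟩ | ⟨z, m, rfl, hxz, hm⟩
    · grind
    · have ih := hm.countP_eq hr hij fun z hz' => hz z (by simp [hz'])
      have := hr _ _ hxz
      have hx := hz x (by simp)
      have hz := hz z (by simp [List.mem_of_mem_head? hm.head])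
      rw [List.countP_cons, List.countP_cons]
      grind
termination_by l => l.length

theorem exists_blocks (h : TwoColoured f R B) {i j : Fin 3} (hij : i ≠ j) {L : List V}
    (hL : ∀ x ∈ L, f x = i ∨ f x = j) (hc : L.countP (f · = i) = L.countP (f · = j)) :
    ∃ P A₁ B₁ A₂ B₂, Blocks f R B i j L P A₁ B₁ A₂ B₂ := by
  classical
  have dfs : ∀ (n : ℕ) (P X Y : List V), 2 * X.length + P.length = n → (P ++ X ++ Y).Perm L →
      P.IsChain R → (∀ x ∈ X, ∀ y ∈ Y, ¬ R x y) → Y.length ≤ X.length →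
      ∃ P X Y : List V, (P ++ X ++ Y).Perm L ∧ P.IsChain R ∧ (∀ x ∈ X, ∀ y ∈ Y, ¬ R x y) ∧
        Y.length = X.length := by
    intro n
    induction n using Nat.strong_induction_on with
    | _ n ih =>
    intro P X Y hn hp hP hXY hle
    rcases hle.eq_or_lt with hle | hlt
    · exact ⟨P, X, Y, hp, hP, hXY, hle⟩
    rcases P with _ | ⟨p, P⟩
    · obtain ⟨x, X, rfl⟩ := List.exists_cons_of_length_pos (Nat.zero_lt_of_lt hlt)
      refine ih _ ?_ [x] X Y rfl (by simpa using hp) (by simp)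
        (fun x' hx' => hXY x' (by simp [hx'])) (by simpa using hlt)
      simp at hn ⊢; omega
    by_cases hx : ∃ x ∈ X, R x p
    · obtain ⟨x, hx, hxp⟩ := hx
      have hX := List.perm_cons_erase hx
      have hXl := hX.length_eq
      simp only [List.length_cons] at hXl hn
      refine ih _ ?_ (x :: p :: P) (X.erase x) Y rfl ?_ (by simpa using ⟨hxp, hP⟩)
        (fun x' hx' => hXY x' (List.mem_of_mem_erase hx')) (by omega)
      · simp; omega
      · refine List.Perm.trans (List.perm_iff_count.2 fun v => ?_) hp
        have := hX.count_eq v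
        simp only [List.count_append, List.count_cons] at *
        omega
    · push Not at hx
      simp only [List.length_cons] at hn
      refine ih _ ?_ P X (p :: Y) rfl ?_ hP.tail ?_ (by simpa using hlt)
      · omega
      · refine List.Perm.trans (List.perm_iff_count.2 fun v => ?_) hp
        simp only [List.count_append, List.count_cons]
        omega
      · intro x hx' y hy
        rcases List.mem_cons.1 hy with rfl | hy
        · exact hx x hx'
        · exact hXY x hx' y hy
  obtain ⟨P, X, Y, hp, hP, hXY, hlen⟩ := dfs _ [] L [] rfl (by simp) (by simp) (by simp) (by simp)
  have hX : ∀ x ∈ X, f x = i ∨ f x = j := fun x hx => hL x (hp.subset (by simp [hx]))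
  have hY : ∀ x ∈ Y, f x = i ∨ f x = j := fun x hx => hL x (hp.subset (by simp [hx]))
  have hPL : ∀ x ∈ P, f x = i ∨ f x = j := fun x hx => hL x (hp.subset (by simp [hx]))
  have part : ∀ Z : List V, (∀ x ∈ Z, f x = i ∨ f x = j) →
      (Z.filter (f · = i) ++ Z.filter (f · = j)).Perm Z := by
    intro Z hZ
    have : Z.filter (f · = j) = Z.filter (fun x => ! decide (f x = i)) :=
      List.filter_congr fun x hx => by have := hZ x hx; grind
    rw [this]
    exact List.filter_append_perm _ _
  have h1 := (part X hX).length_eq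
  have h2 := (part Y hY).length_eq
  rw [List.length_append] at h1 h2
  have h3 : P.countP (f · = i) = P.countP (f · = j) ∨
      P.countP (f · = i) = P.countP (f · = j) + 1 ∨
        P.countP (f · = i) + 1 = P.countP (f · = j) := by
    rcases eq_or_ne P [] with rfl | hne
    · simp
    · obtain ⟨x, y, hxy⟩ := IsSeg.exists_of_ne_nil hP hne
      have hx := hPL x (List.mem_of_mem_head? hxy.head)
      have hy := hPL y (List.mem_of_getLast? hxy.last)
      have := hxy.countP_eq h.red_ne hij hPL
      grind
  rw [← hp.countP_eq, ← hp.countP_eq] at hc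
  simp only [List.countP_append] at hc
  simp only [List.countP_eq_length_filter] at hc h3
  refine ⟨P, X.filter (f · = i), Y.filter (f · = j), Y.filter (f · = i), X.filter (f · = j),
    List.Perm.trans (List.perm_iff_count.2 fun v => ?_) hp, hP, by simp, by simp, by simp, by simp,
    by omega, by omega, ?_, ?_⟩
  · have e1 := (part X hX).count_eq v
    have e2 := (part Y hY).count_eq v
    simp only [List.count_append] at *
    omega
  · simp only [List.mem_filter, decide_eq_true_eq]
    rintro a ⟨ha, hai⟩ b ⟨hb, hbj⟩
    exact (h.cover a b (by grind)).resolve_left (hXY a ha b hb)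
  · simp only [List.mem_filter, decide_eq_true_eq]
    rintro a ⟨ha, hai⟩ b ⟨hb, hbj⟩
    exact (h.cover a b (by grind)).resolve_left fun hr => hXY b hb a ha (h.red_symm _ _ hr)

theorem IsSeg.split {r : V → V → Prop} {x y w : V} {S T : List V} (hl : IsSeg r x y (S ++ w :: T)) :
    IsSeg r x w (S ++ [w]) ∧ IsSeg r w y (w :: T) := by
  obtain ⟨h1, h2, h3⟩ := hl
  rw [List.isChain_append] at h1
  refine ⟨⟨?_, ?_, by simp⟩, h1.2.1, rfl, ?_⟩
  · rw [List.isChain_append]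
    exact ⟨h1.1, by simp, by simpa using h1.2.2⟩
  · cases S <;> simpa using h2
  · simpa using h3

/-- A cycle can be opened at any vertex. -/
theorem IsSeg.rotate {r : V → V → Prop} {x y u : V} {C : List V} (hC : IsSeg r x y C)
    (hyx : r y x) (hu : u ∈ C) : ∃ l s, IsSeg r s u l ∧ r u s ∧ l.Perm C := by
  obtain ⟨S, T, rfl⟩ := List.append_of_mem hu
  obtain ⟨h1, h2⟩ := hC.split
  rcases h2.uncons with ⟨h, rfl⟩ | ⟨t, m, h, hut, hm⟩
  · obtain rfl : T = [] := by simpa using h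
    exact ⟨_, _, hC, hyx, List.Perm.refl _⟩
  · obtain rfl : T = m := by simpa using h
    refine ⟨_, _, hm.append hyx h1, hut, ?_⟩
    simpa using (List.perm_append_comm (l₁ := T) (l₂ := S ++ [u]))

/-- A red cycle `C` together with two almost balanced complete blue bipartite graphs, with the
colours of most of the remaining edges prescribed. -/
structure CycleBlocks {V : Type*} (f : V → Fin 3) (R B : V → V → Prop) (i j : Fin 3)
    (L C A₁ B₁ A₂ B₂ : List V) (p y : V) : Prop where
  perm : (C ++ A₁ ++ B₁ ++ A₂ ++ B₂).Perm L
  seg : IsSeg R p y C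
  close : R y p
  fst_head : f p = i
  fst₁ : ∀ a ∈ A₁, f a = i
  snd₁ : ∀ b ∈ B₁, f b = j
  fst₂ : ∀ a ∈ A₂, f a = i
  snd₂ : ∀ b ∈ B₂, f b = j
  len₁ : A₁.length = B₁.length + 1
  len₂ : B₂.length = A₂.length + 1
  blue₁ : ∀ a ∈ A₁, ∀ b ∈ B₁, B a b
  blue₂ : ∀ a ∈ A₂, ∀ b ∈ B₂, B a b
  red₁ : ∀ a ∈ A₁, ∀ b ∈ B₂, R a b
  red₂ : ∀ a ∈ A₂, ∀ b ∈ B₁, R a b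
  blue_fst : ∀ u ∈ C, f u = i → ∀ b ∈ B₂, B u b
  blue_snd : ∀ w ∈ C, f w = j → ∀ a ∈ A₁, B a w

namespace CycleBlocks

variable {i j : Fin 3} {L C A₁ B₁ A₂ B₂ : List V} {p y : V}

theorem class_of_mem (hB : CycleBlocks f R B i j L C A₁ B₁ A₂ B₂ p y)
    (hL : ∀ x ∈ L, f x = i ∨ f x = j) {x : V} (hx : x ∈ C) : f x = i ∨ f x = j :=
  hL x (hB.perm.subset (by simp [hx]))

theorem blocks_of_seg (hB : CycleBlocks f R B i j L C A₁ B₁ A₂ B₂ p y) {u w : V} {m : List V}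
    (hm : m.IsChain R) (hp : (u :: w :: m).Perm C) (hu : f u = i) (hw : f w = j) :
    Blocks f R B i j L m A₁ (w :: B₁) (u :: A₂) B₂ := by
  classical
  have huC : u ∈ C := hp.subset (by simp)
  have hwC : w ∈ C := hp.subset (by simp)
  refine ⟨List.Perm.trans (List.perm_iff_count.2 fun v => ?_) hB.perm, hm, hB.fst₁, ?_, ?_,
    hB.snd₂, hB.len₁, hB.len₂.symm, ?_, ?_⟩
  · have := hp.count_eq v
    simp only [List.count_append, List.count_cons] at *
    omega
  · simpa [hw] using hB.snd₁
  · simpa [hu] using hB.fst₂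
  · have := hB.blue₁
    have := hB.blue_snd w hwC hw
    simp; grind
  · have := hB.blue₂
    have := hB.blue_fst u huC hu
    simp; grind

theorem red_fst (hB : CycleBlocks f R B i j L C A₁ B₁ A₂ B₂ p y) (h : TwoColoured f R B)
    (hij : i ≠ j) (hL : ∀ x ∈ L, f x = i ∨ f x = j) (hn : ¬ HasBiPath f R B L) {u b : V}
    (hu : u ∈ C) (hui : f u = i) (hb : b ∈ B₁) : R u b := by
  refine (h.cover u b ?_).resolve_right fun hub => hn ?_
  · rw [hui, hB.snd₁ b hb]; exact hij
  obtain ⟨l, s, hl, hus, hp⟩ := hB.seg.rotate hB.close hu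
  have hs := hB.class_of_mem hL (hp.subset (List.mem_of_mem_head? hl.head))
  have hne := h.red_ne _ _ hus
  rcases hl.unsnoc with ⟨rfl, rfl⟩ | ⟨z, m, rfl, hm, -⟩
  · exact absurd rfl hne
  obtain ⟨m, rfl⟩ := hm.exists_cons
  have hm' := hB.blocks_of_seg (m := m) hm.chain.tail
    (List.Perm.trans (List.perm_append_comm (l₁ := [u])) hp) hui (by grind)
  exact hm'.symm.hasBiPath_of_blue h hij hL (a := u) (b := b) (by simp) (by simp [hb]) hub

theorem red_snd (hB : CycleBlocks f R B i j L C A₁ B₁ A₂ B₂ p y) (h : TwoColoured f R B)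
    (hij : i ≠ j) (hL : ∀ x ∈ L, f x = i ∨ f x = j) (hn : ¬ HasBiPath f R B L) {w a : V}
    (hw : w ∈ C) (hwj : f w = j) (ha : a ∈ A₂) : R a w := by
  refine (h.cover a w ?_).resolve_right fun haw => hn ?_
  · rw [hwj, hB.fst₂ a ha]; exact hij
  obtain ⟨l, s, hl, hws, hp⟩ := hB.seg.rotate hB.close hw
  have hs := hB.class_of_mem hL (hp.subset (List.mem_of_mem_head? hl.head))
  have hne := h.red_ne _ _ hws
  rcases hl.unsnoc with ⟨rfl, rfl⟩ | ⟨z, m, rfl, hm, -⟩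
  · exact absurd rfl hne
  obtain ⟨m, rfl⟩ := hm.exists_cons
  have hm' := hB.blocks_of_seg (m := m) (u := s) (w := w) hm.chain.tail
    (List.Perm.trans (by simpa using (List.perm_append_comm (l₁ := [w]) (l₂ := m)).cons s) hp)
    (by grind) hwj
  exact hm'.symm.hasBiPath_of_blue h hij hL (a := a) (b := w) (by simp [ha]) (by simp) haw

theorem red_chord (hB : CycleBlocks f R B i j L C A₁ B₁ A₂ B₂ p y) (h : TwoColoured f R B)
    (hij : i ≠ j) (hL : ∀ x ∈ L, f x = i ∨ f x = j) (hn : ¬ HasBiPath f R B L) {u w : V}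
    (hu : u ∈ C) (hui : f u = i) (hw : w ∈ C) (hwj : f w = j) : R u w := by
  classical
  by_contra hR
  have hub : B u w := (h.cover u w (by grind)).resolve_left hR
  apply hn
  obtain ⟨l, s, hl, hus, hp⟩ := hB.seg.rotate hB.close hu
  have hcl : ∀ x ∈ l, f x = i ∨ f x = j := fun x hx => hB.class_of_mem hL (hp.subset hx)
  have blue_fst : ∀ u ∈ l, f u = i → ∀ b ∈ B₂, B u b := fun u hu => hB.blue_fst u (hp.subset hu)
  have blue_snd : ∀ w ∈ l, f w = j → ∀ a ∈ A₁, B a w := fun u hu => hB.blue_snd u (hp.subset hu)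
  obtain ⟨S, T, rfl⟩ := List.append_of_mem (hp.mem_iff.2 hw)
  obtain ⟨hlw, hT⟩ := hl.split
  rcases hlw.uncons with ⟨-, rfl⟩ | ⟨s₂, S₁, hS₁, hs, hsw⟩
  · exact absurd hus hR
  rcases hsw.unsnoc with ⟨-, rfl⟩ | ⟨w₁, S₂, rfl, hS, hw₁⟩
  · have := h.red_ne _ _ hs
    have := h.red_ne _ _ hus
    have := hcl s (List.mem_of_mem_head? hl.head)
    grind
  obtain rfl : S = s :: S₂ := by
    rw [← List.cons_append, List.append_left_inj] at hS₁; exact hS₁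
  rcases hT.uncons with ⟨-, rfl⟩ | ⟨t, T₁, hT₁, hwt, hT⟩
  · exact absurd (hui.symm.trans hwj) hij
  obtain rfl : T = T₁ := by simpa using hT₁
  rcases hT.unsnoc with ⟨-, rfl⟩ | ⟨u₁, T₁, rfl, hT, hu₁⟩
  · exact absurd (h.red_symm _ _ hwt) hR
  have hs₂ := List.mem_of_mem_head? hS.head
  have hu₁T := List.mem_of_getLast? hT.last
  have hsj : f s = j := by
    have := hcl s (by simp)
    have := h.red_ne _ _ hus
    grind
  have hs₂i : f s₂ = i := by
    have := hcl s₂ (by simp [hs₂])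
    have := h.red_ne _ _ hs
    grind
  have hu₁j : f u₁ = j := by
    have := hcl u₁ (by simp [hu₁T])
    have := h.red_ne _ _ hu₁
    grind
  have hti : f t = i := by
    have := hcl t (by simp [List.mem_of_mem_head? hT.head])
    have := h.red_ne _ _ hwt
    grind
  obtain ⟨a, ha⟩ := List.exists_mem_of_length_pos (l := A₁) (by have := hB.len₁; omega)
  obtain ⟨b, hb⟩ := List.exists_mem_of_length_pos (l := B₂) (by have := hB.len₂; omega)
  obtain ⟨Q₁, hQ₁, hp₁⟩ := exists_isSeg_of_mem h.blue_symm (A := A₁) (D := s :: B₁) (d := s) ha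
    (by simp) (by simpa using hB.len₁) (by
      have := hB.blue₁
      have := blue_snd s (by simp) hsj
      simp; grind)
  obtain ⟨Q₂, hQ₂, hp₂⟩ := exists_isSeg_of_mem h.blue_symm (A := u :: A₂) (D := B₂) (a := u)
    (by simp) hb (by simpa using hB.len₂.symm) (by
      have := hB.blue₂
      have := blue_fst u (by simp) hui
      simp; grind)
  have hQ₁ := hQ₁.reverse h.blue_symm
  rcases h.cover u₁ s₂ (by grind) with hr | hbl
  · have hP := (hS.reverse h.red_symm).append (h.red_symm _ _ hr) (hT.reverse h.red_symm)
    have hQ := hQ₁.append (blue_snd w (by simp) hwj a ha) (IsSeg.cons (h.blue_symm _ _ hub) hQ₂)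
    refine ⟨_, _, hP.biPath hQ (by grind), ?_⟩
    refine List.Perm.trans (List.perm_iff_count.2 fun v => ?_) hB.perm
    have e1 := hp.count_eq v
    have e2 := hp₁.count_eq v
    have e3 := hp₂.count_eq v
    simp only [List.count_append, List.count_cons, List.count_nil, List.count_reverse] at *
    omega
  · have hQ := hQ₁.append (blue_snd u₁ (by simp [hu₁T]) hu₁j a ha) (IsSeg.cons hbl
      (IsSeg.cons (blue_fst s₂ (by simp [hs₂]) hs₂i b hb) (hQ₂.reverse h.blue_symm)))
    rcases hT.unsnoc with ⟨-, rfl⟩ | ⟨t', T', rfl, hT', ht'⟩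
    · exact absurd (hti.symm.trans hu₁j) hij
    obtain ⟨S', rfl⟩ := hS.exists_cons
    have hP : (S' ++ w :: T').IsChain R := by
      refine hl.chain.infix ⟨[s, s₂], [u₁, u], by simp⟩
    have ht'i : f t' ≠ j := hu₁j ▸ h.red_ne _ _ ht'
    refine ⟨_, _, ⟨hP, hQ.chain, ?_⟩, List.Perm.trans (List.perm_iff_count.2 fun v => ?_) hB.perm⟩
    · simpa [List.getLast?_cons, hT'.last, hQ.head, hsj] using ht'i
    have e1 := hp.count_eq v
    have e2 := hp₁.count_eq v
    have e3 := hp₂.count_eq v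
    simp only [List.count_append, List.count_cons, List.count_nil, List.count_reverse] at *
    omega

theorem hasSplit (hB : CycleBlocks f R B i j L C A₁ B₁ A₂ B₂ p y) (h : TwoColoured f R B)
    (hij : i ≠ j) (hL : ∀ x ∈ L, f x = i ∨ f x = j) (hn : ¬ HasBiPath f R B L) :
    HasSplit f R B i j L := by
  classical
  have hp := List.mem_of_mem_head? hB.seg.head
  have hy := List.mem_of_getLast? hB.seg.last
  have hyj : f y = j := by
    have := hB.class_of_mem hL hy
    have := h.red_ne _ _ hB.close
    have := hB.fst_head
    grind
  have hC : (C.filter (f · = i) ++ C.filter (f · = j)).Perm C := by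
    have : C.filter (f · = j) = C.filter (fun x => ! decide (f x = i)) :=
      List.filter_congr fun x hx => by have := hB.class_of_mem hL hx; grind
    rw [this]
    exact List.filter_append_perm _ _
  refine ⟨A₁, C.filter (f · = i) ++ A₂, B₂, C.filter (f · = j) ++ B₁,
    List.Perm.trans (List.perm_iff_count.2 fun v => ?_) hB.perm, ?_, ?_, ?_, ?_, hB.fst₁, ?_,
    hB.snd₂, ?_, hB.red₁, ?_, ?_, ?_⟩
  · have e1 := hC.count_eq v
    simp only [List.count_append] at *
    omega
  · rintro rfl
    simpa using hB.len₁
  · exact List.ne_nil_of_mem (a := p) (by simp [hp, hB.fst_head])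
  · rintro rfl
    simpa using hB.len₂
  · exact List.ne_nil_of_mem (a := y) (by simp [hy, hyj])
  · have := hB.fst₂
    simp; grind
  · have := hB.snd₁
    simp; grind
  · simp only [List.mem_append, List.mem_filter, decide_eq_true_eq]
    rintro a (⟨ha, hai⟩ | ha) d (⟨hd, hdj⟩ | hd)
    · exact hB.red_chord h hij hL hn ha hai hd hdj
    · exact hB.red_fst h hij hL hn ha hai hd
    · exact hB.red_snd h hij hL hn hd hdj ha
    · exact hB.red₂ a ha d hd
  · have := hB.blue_fst
    have := hB.blue₂
    simp; grind
  · have := hB.blue_snd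
    have := hB.blue₁
    simp; grind

end CycleBlocks

namespace Blocks

variable {i j : Fin 3} {L P A₁ B₁ A₂ B₂ : List V}

theorem erase_fst [DecidableEq V] (hB : Blocks f R B i j L P A₁ B₁ A₂ B₂) {P' : List V} {a b : V}
    (ha : a ∈ A₁) (hb : b ∈ B₁) (hP : P'.IsChain R) (hp : P'.Perm (a :: b :: P)) :
    Blocks f R B i j L P' (A₁.erase a) (B₁.erase b) A₂ B₂ := by
  have hA := List.perm_cons_erase ha
  have hB' := List.perm_cons_erase hb
  refine ⟨List.Perm.trans (List.perm_iff_count.2 fun v => ?_) hB.perm, hP,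
    fun a ha => hB.fst₁ a (List.mem_of_mem_erase ha),
    fun b hb => hB.snd₁ b (List.mem_of_mem_erase hb), hB.fst₂, hB.snd₂, ?_, hB.len₂,
    fun a ha b hb => hB.blue₁ a (List.mem_of_mem_erase ha) b (List.mem_of_mem_erase hb), hB.blue₂⟩
  · have e1 := hA.count_eq v
    have e2 := hB'.count_eq v
    have e3 := hp.count_eq v
    simp only [List.count_append, List.count_cons] at *
    omega
  · rw [List.length_erase_of_mem ha, List.length_erase_of_mem hb, hB.len₁]

theorem hasSplit_of_ends {p q : V} (hB : Blocks f R B i j L P A₁ B₁ A₂ B₂)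
    (h : TwoColoured f R B) (hij : i ≠ j) (hL : ∀ x ∈ L, f x = i ∨ f x = j)
    (hn : ¬ HasBiPath f R B L)
    (hmax : ∀ P' A₁' B₁' A₂' B₂', Blocks f R B i j L P' A₁' B₁' A₂' B₂' → P'.length ≤ P.length)
    (hP : IsSeg R p q P) (hp : f p = i) (hpb : ∀ b ∈ B₁, R p b) (hqa : ∀ a ∈ A₂, R q a)
    (hred₁ : ∀ a ∈ A₁, ∀ b ∈ B₂, R a b) (hred₂ : ∀ a ∈ A₂, ∀ b ∈ B₁, R a b)
    (hA₁ : A₁ ≠ []) (hA₂ : A₂ ≠ []) : HasSplit f R B i j L := by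
  classical
  obtain ⟨v₀, hv₀⟩ := List.exists_mem_of_ne_nil _ hA₁
  obtain ⟨x, hx⟩ := List.exists_mem_of_ne_nil _ hA₂
  obtain ⟨y, hy⟩ := List.exists_mem_of_length_pos (l := B₁) (hB.len₁ ▸ List.length_pos_of_mem hv₀)
  obtain ⟨z₀, hz₀⟩ := List.exists_mem_of_length_pos (l := B₂) (hB.len₂ ▸ List.length_pos_of_mem hx)
  have hxp := List.perm_cons_erase hx
  have hyp := List.perm_cons_erase hy
  have hC : IsSeg R p y (P ++ [x, y]) := hP.append (hqa x hx) (IsSeg.pair (hred₂ x hx y hy))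
  have hyp' := h.red_symm _ _ (hpb y hy)
  have long : ∀ (l : List V) (v z : V), l.IsChain R → v ∈ A₁ → z ∈ B₂ →
      l.Perm (v :: z :: (P ++ [x, y])) → False := by
    intro l v z hl hv hz hlp
    have hvp := List.perm_cons_erase hv
    have hzp := List.perm_cons_erase hz
    have := hxp.length_eq
    have := hyp.length_eq
    have := hvp.length_eq
    have := hzp.length_eq
    have := hB.len₁
    have := hB.len₂
    have hlen := hlp.length_eq
    simp only [List.length_append, List.length_cons] at *
    have := hmax l (A₁.erase v) (B₁.erase y) (A₂.erase x) (B₂.erase z)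
      ⟨List.Perm.trans (List.perm_iff_count.2 fun w => by
          have e1 := hxp.count_eq w
          have e2 := hyp.count_eq w
          have e3 := hvp.count_eq w
          have e4 := hzp.count_eq w
          have e5 := hlp.count_eq w
          simp only [List.count_append, List.count_cons, List.count_nil] at *
          omega) hB.perm, hl, fun a ha => hB.fst₁ a (List.mem_of_mem_erase ha),
        fun b hb => hB.snd₁ b (List.mem_of_mem_erase hb),
        fun a ha => hB.fst₂ a (List.mem_of_mem_erase ha),
        fun b hb => hB.snd₂ b (List.mem_of_mem_erase hb), by omega, by omega,
        fun a ha b hb => hB.blue₁ a (List.mem_of_mem_erase ha) b (List.mem_of_mem_erase hb),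
        fun a ha b hb => hB.blue₂ a (List.mem_of_mem_erase ha) b (List.mem_of_mem_erase hb)⟩
    simp only [List.length_nil] at *
    omega
  have hcy : CycleBlocks f R B i j L (P ++ [x, y]) A₁ (B₁.erase y) (A₂.erase x) B₂ p y := by
    refine ⟨List.Perm.trans (List.perm_iff_count.2 fun w => ?_) hB.perm, hC, hyp', hp, hB.fst₁,
      fun b hb => hB.snd₁ b (List.mem_of_mem_erase hb),
      fun a ha => hB.fst₂ a (List.mem_of_mem_erase ha), hB.snd₂, ?_, ?_,
      fun a ha b hb => hB.blue₁ a ha b (List.mem_of_mem_erase hb),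
      fun a ha b hb => hB.blue₂ a (List.mem_of_mem_erase ha) b hb, hred₁,
      fun a ha b hb => hred₂ a (List.mem_of_mem_erase ha) b (List.mem_of_mem_erase hb), ?_, ?_⟩
    · have e1 := hxp.count_eq w
      have e2 := hyp.count_eq w
      simp only [List.count_append, List.count_cons, List.count_nil] at *
      omega
    · rw [hB.len₁, hyp.length_eq]; simp
    · rw [← hB.len₂, hxp.length_eq]; simp
    · intro u hu hui b hb
      refine (h.cover u b (by rw [hui, hB.snd₂ b hb]; exact hij)).resolve_left fun hr => ?_
      obtain ⟨l, s, hl, -, hlp⟩ := hC.rotate hyp' hu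
      refine long _ v₀ b (hl.append hr (IsSeg.pair (h.red_symm _ _ (hred₁ v₀ hv₀ b hb)))).chain
        hv₀ hb (List.Perm.trans ?_ ((hlp.cons b).cons v₀))
      rw [List.perm_iff_count]
      intro w
      simp only [List.count_append, List.count_cons, List.count_nil] at *
      omega
    · intro w hw hwj a ha
      refine (h.cover a w (by rw [hwj, hB.fst₁ a ha]; exact hij)).resolve_left fun hr => ?_
      obtain ⟨l, s, hl, -, hlp⟩ := hC.rotate hyp' hw
      refine long _ a z₀ (hl.append (h.red_symm _ _ hr) (IsSeg.pair (hred₁ a ha z₀ hz₀))).chain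
        ha hz₀ (List.Perm.trans ?_ ((hlp.cons z₀).cons a))
      rw [List.perm_iff_count]
      intro w
      simp only [List.count_append, List.count_cons, List.count_nil] at *
      omega
  exact hcy.hasSplit h hij hL hn

theorem hasSplit_of_seg {p q : V} (hB : Blocks f R B i j L P A₁ B₁ A₂ B₂)
    (h : TwoColoured f R B) (hij : i ≠ j) (hL : ∀ x ∈ L, f x = i ∨ f x = j)
    (hn : ¬ HasBiPath f R B L)
    (hmax : ∀ P' A₁' B₁' A₂' B₂', Blocks f R B i j L P' A₁' B₁' A₂' B₂' → P'.length ≤ P.length)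
    (hP : IsSeg R p q P) (hp : f p = i) (hq : f q = j) : HasSplit f R B i j L := by
  classical
  have hred : ∀ {A₁ B₁ A₂ B₂ : List V}, Blocks f R B i j L P A₁ B₁ A₂ B₂ →
      ∀ a ∈ A₁, ∀ b ∈ B₂, R a b := fun hB a ha b hb =>
    (h.cover a b (by rw [hB.fst₁ a ha, hB.snd₂ b hb]; exact hij)).resolve_right
      fun hab => hn (hB.hasBiPath_of_blue h hij hL ha hb hab)
  have hne : ∀ {A₁ B₁ A₂ B₂ : List V}, Blocks f R B i j L P A₁ B₁ A₂ B₂ → A₁ ≠ [] := fun hB hA =>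
    hn (hB.hasBiPath_of_eq_nil h hij hL hA)
  have hpr : (∀ b ∈ B₁, R p b) ∨ ∀ b ∈ B₂, R p b := by
    by_contra! ⟨⟨b₁, hb₁, hpb₁⟩, b₂, hb₂, hpb₂⟩
    exact hn (hB.hasBiPath_of_end h hij hP hp hq hb₁ hb₂
      ((h.cover p b₁ (by rw [hp, hB.snd₁ _ hb₁]; exact hij)).resolve_left hpb₁)
      ((h.cover p b₂ (by rw [hp, hB.snd₂ _ hb₂]; exact hij)).resolve_left hpb₂))
  have hqr : (∀ a ∈ A₁, R q a) ∨ ∀ a ∈ A₂, R q a := by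
    by_contra! ⟨⟨a₁, ha₁, hqa₁⟩, a₂, ha₂, hqa₂⟩
    exact hn ((hB.flip h).hasBiPath_of_end h hij.symm
      (hP.reverse h.red_symm) hq hp ha₁ ha₂
      ((h.cover q a₁ (by rw [hq, hB.fst₁ _ ha₁]; exact hij.symm)).resolve_left hqa₁)
      ((h.cover q a₂ (by rw [hq, hB.fst₂ _ ha₂]; exact hij.symm)).resolve_left hqa₂))
  have hext : ∀ {A₁ B₁ A₂ B₂ : List V}, Blocks f R B i j L P A₁ B₁ A₂ B₂ →
      (∀ b ∈ B₁, R p b) → (∀ a ∈ A₁, R q a) → False := by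
    intro A₁ B₁ A₂ B₂ hB hb ha
    obtain ⟨a, haA⟩ := List.exists_mem_of_ne_nil _ (hne hB)
    obtain ⟨b, hbB⟩ := List.exists_mem_of_length_pos (l := B₁)
      (hB.len₁ ▸ List.length_pos_of_mem haA)
    have hp : (b :: P ++ [a]).Perm (a :: b :: P) := List.perm_append_comm (l₂ := [a])
    have := hmax _ _ _ _ _ (hB.erase_fst haA hbB
      ((hP.cons (h.red_symm _ _ (hb b hbB))).snoc (ha a haA)).chain hp)
    simp at this
  rcases hpr with hp' | hp' <;> rcases hqr with hq' | hq'
  · exact (hext hB hp' hq').elim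
  · exact hB.hasSplit_of_ends h hij hL hn hmax hP hp hp' hq' (hred hB) (hred hB.symm) (hne hB)
      (hne hB.symm)
  · exact hB.symm.hasSplit_of_ends h hij hL hn hmax hP hp hp' hq' (hred hB.symm) (hred hB)
      (hne hB.symm) (hne hB)
  · exact (hext hB.symm hp' hq').elim

end Blocks

theorem countP_of_forall {k l : Fin 3} {X : List V} (hX : ∀ x ∈ X, f x = l) :
    X.countP (f · = k) = if l = k then X.length else 0 := by
  split_ifs with hlk
  · exact List.countP_eq_length.2 fun x hx => by simpa [hX x hx] using hlk
  · exact List.countP_eq_zero.2 fun x hx => by simpa [hX x hx] using hlk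

/-- A two-coloured balanced complete bipartite graph either has a red path and a blue path covering
all vertices or its colouring is split. -/
theorem hasBiPath_or_hasSplit (h : TwoColoured f R B) {i j : Fin 3} (hij : i ≠ j) {L : List V}
    (hL : ∀ x ∈ L, f x = i ∨ f x = j) (hc : L.countP (f · = i) = L.countP (f · = j)) :
    HasBiPath f R B L ∨ HasSplit f R B i j L := by
  classical
  by_cases hn : HasBiPath f R B L
  · exact Or.inl hn
  refine Or.inr ?_
  let s : ℕ → Prop := fun n => ∃ P A₁ B₁ A₂ B₂, Blocks f R B i j L P A₁ B₁ A₂ B₂ ∧ P.length = n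
  have hbound : ∀ {P A₁ B₁ A₂ B₂}, Blocks f R B i j L P A₁ B₁ A₂ B₂ → P.length ≤ L.length := by
    intro P A₁ B₁ A₂ B₂ hB
    have := hB.perm.length_eq
    simp only [List.length_append] at this
    omega
  obtain ⟨P₀, A₁, B₁, A₂, B₂, hB₀⟩ := exists_blocks h hij hL hc
  obtain ⟨P, A₁, B₁, A₂, B₂, hB, hlen⟩ : s (Nat.findGreatest s L.length) :=
    Nat.findGreatest_spec (hbound hB₀) ⟨_, _, _, _, _, hB₀, rfl⟩
  have hmax : ∀ P' A₁' B₁' A₂' B₂', Blocks f R B i j L P' A₁' B₁' A₂' B₂' →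
      P'.length ≤ P.length := by
    intro P' A₁' B₁' A₂' B₂' hB'
    rw [hlen]
    exact Nat.le_findGreatest (hbound hB') ⟨_, _, _, _, _, hB', rfl⟩
  rcases eq_or_ne P [] with rfl | hP
  · have hred : ∀ {A₁ B₁ A₂ B₂ : List V}, Blocks f R B i j L [] A₁ B₁ A₂ B₂ →
        ∀ a ∈ A₁, ∀ b ∈ B₂, R a b := fun hB a ha b hb =>
      (h.cover a b (by rw [hB.fst₁ a ha, hB.snd₂ b hb]; exact hij)).resolve_right
        fun hab => hn (hB.hasBiPath_of_blue h hij hL ha hb hab)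
    have hne : ∀ {A₁ B₁ A₂ B₂ : List V}, Blocks f R B i j L [] A₁ B₁ A₂ B₂ → A₁ ≠ [] ∧ B₁ ≠ [] :=
      fun hB => ⟨fun hA => hn (hB.hasBiPath_of_eq_nil h hij hL hA), fun hA =>
        hn (hB.hasBiPath_of_eq_nil h hij hL
          (List.length_eq_zero_iff.1 (by rw [hB.len₁, hA]; rfl)))⟩
    refine ⟨A₁, A₂, B₂, B₁, List.Perm.trans (List.perm_iff_count.2 fun v => ?_) hB.perm,
      (hne hB).1, (hne hB.symm).1, (hne hB.symm).2, (hne hB).2, hB.fst₁, hB.fst₂, hB.snd₂,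
      hB.snd₁, hred hB, hred hB.symm, hB.blue₂, hB.blue₁⟩
    simp only [List.count_append, List.count_nil]
    omega
  obtain ⟨p, q, hpq⟩ := IsSeg.exists_of_ne_nil hB.chain hP
  have hPL : ∀ x ∈ P, f x = i ∨ f x = j := fun x hx => hL x (hB.perm.subset (by simp [hx]))
  have hp := hPL p (List.mem_of_mem_head? hpq.head)
  have hq := hPL q (List.mem_of_getLast? hpq.last)
  have hcount : P.countP (f · = i) = P.countP (f · = j) := by
    rw [← hB.perm.countP_eq, ← hB.perm.countP_eq] at hc
    simp only [List.countP_append, countP_of_forall hB.fst₁, countP_of_forall hB.snd₁,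
      countP_of_forall hB.fst₂, countP_of_forall hB.snd₂] at hc
    have := hB.len₁
    have := hB.len₂
    simp only [if_true, hij, hij.symm, if_false] at hc
    omega
  have hcc := hpq.countP_eq h.red_ne hij hPL
  rcases hp with hp | hp <;> rcases hq with hq | hq
  · have := hcc.1 hp hq
    omega
  · exact hB.hasSplit_of_seg h hij hL hn hmax hpq hp hq
  · have hB' : Blocks f R B i j L P.reverse A₁ B₁ A₂ B₂ :=
      { hB with
        perm := List.Perm.trans (List.perm_iff_count.2 fun v => by
          simp only [List.count_append, List.count_reverse]) hB.perm
        chain := isChain_reverse_of_symm h.red_symm hB.chain }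
    exact hB'.hasSplit_of_seg h hij hL hn (by simpa using hmax) (hpq.reverse h.red_symm) hq hp
  · have := hcc.2.2.2 hp hq
    omega

theorem TwoColoured.merge (h : TwoColoured f R B) {g : V → Fin 3}
    (hg : ∀ x y, g x ≠ g y → f x ≠ f y) :
    TwoColoured g (fun x y => R x y ∧ g x ≠ g y) fun x y => B x y ∧ g x ≠ g y :=
  ⟨fun _ _ hxy => ⟨h.red_symm _ _ hxy.1, hxy.2.symm⟩,
    fun _ _ hxy => ⟨h.blue_symm _ _ hxy.1, hxy.2.symm⟩,
    fun x y hxy => (h.cover x y (hg x y hxy)).imp (⟨·, hxy⟩) (⟨·, hxy⟩),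
    fun _ _ hxy => hxy.2, fun _ _ hxy => hxy.2⟩

theorem hasBiPath_of_countP_eq (h : TwoColoured f R B) {L : List V}
    (hne : ∀ i, 1 ≤ L.countP (f · = i)) {i : Fin 3} (hi : 2 * L.countP (f · = i) = L.length) :
    HasBiPath f R B L := by
  classical
  let g : V → Fin 3 := fun x => if f x = i then 0 else 1
  have hg0 : ∀ x, g x = 0 ↔ f x = i := fun x => by simp only [g]; split_ifs <;> simp_all
  have hg1 : ∀ x, g x = 1 ↔ f x ≠ i := fun x => by simp only [g]; split_ifs <;> simp_all
  have hg : ∀ x y, g x ≠ g y → f x ≠ f y := fun x y hxy hf => hxy (by simp only [g, hf])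
  have hc : L.countP (g · = 0) = L.countP (g · = 1) := by
    have h2 := List.length_eq_countP_add_countP (l := L) (f · = i)
    have h3 : L.countP (g · = 0) = L.countP (f · = i) := by simp only [hg0]
    have h4 : L.countP (g · = 1) = L.countP (fun x => ¬ (decide (f x = i)) = true) := by
      simp only [hg1, decide_eq_true_eq]
    omega
  rcases hasBiPath_or_hasSplit (h.merge hg) (i := 0) (j := 1) (by decide) (L := L)
    (fun x _ => by simp only [g]; split_ifs <;> simp) hc with
    ⟨P, Q, ⟨hP, hQ, hj⟩, hp⟩ |
    ⟨A, A', D, D', hp, hA, hA', hD, hD', hAi, hAi', hDj, hDj', hAD, hAD', hb, hb'⟩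
  · exact ⟨P, Q, ⟨hP.imp fun _ _ h => h.1, hQ.imp fun _ _ h => h.1,
      fun x hx y hy => hg x y (hj x hx y hy)⟩, hp⟩
  have hlen : A.length + A'.length = D.length + D'.length := by
    rw [← hp.countP_eq, ← hp.countP_eq] at hc
    simpa [countP_of_forall hAi, countP_of_forall hAi', countP_of_forall hDj,
      countP_of_forall hDj'] using hc
  obtain ⟨d, hd, d', hd', hdd⟩ : ∃ d ∈ D, ∃ d' ∈ D', f d ≠ f d' := by
    by_contra! hall
    obtain ⟨d, hd⟩ := List.exists_mem_of_ne_nil _ hD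
    obtain ⟨d', hd'⟩ := List.exists_mem_of_ne_nil _ hD'
    obtain ⟨k, hk, hk'⟩ : ∃ k : Fin 3, k ≠ i ∧ k ≠ f d := by
      exact (by decide : ∀ i l : Fin 3, ∃ k, k ≠ i ∧ k ≠ l) i (f d)
    obtain ⟨x, hx, hxk⟩ := List.countP_pos_iff.1 (hne k)
    rw [← hp.mem_iff] at hx
    simp only [List.mem_append] at hx
    simp only [hg0] at hAi hAi'
    have e1 := hall d hd d' hd'
    have e2 : x ∈ D → f x = f d' := fun hx => hall x hx d' hd'
    have e3 : x ∈ D' → f d = f x := fun hx => hall d hd x hx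
    have e4 := hAi x
    have e5 := hAi' x
    simp only [decide_eq_true_eq] at hxk
    grind
  rcases h.cover d d' hdd with hr | hbl
  · refine HasBiPath.perm (hasBiPath_of_split h (m := []) (fun a ha d hd => (hAD a ha d hd).1)
      (fun a ha d hd => (hAD' a ha d hd).1) (fun a ha d hd => (hb a ha d hd).1)
      (fun a ha d hd => (hb' a ha d hd).1) hlen hA hA' hD hD' (Or.inr hd) (Or.inr hd')
      (IsSeg.pair hr)) (by simpa using hp)
  · refine HasBiPath.swap h.swap (HasBiPath.perm (hasBiPath_of_split h.swap (m := [])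
      (fun a ha d hd => (hb' a ha d hd).1) (fun a ha d hd => (hb a ha d hd).1)
      (fun a ha d hd => (hAD' a ha d hd).1) (fun a ha d hd => (hAD a ha d hd).1)
      (by omega) hA hA' hD' hD (Or.inr hd') (Or.inr hd)
      (IsSeg.pair (h.blue_symm _ _ hbl))) (List.Perm.trans (List.perm_iff_count.2 fun v => ?_) hp))
    simp only [List.count_append, List.count_nil]
    omega

theorem HasBiPath.cons_of_forall_ne (h : TwoColoured f R B) {v : V} {L : List V}
    (hv : ∀ x ∈ L, f v ≠ f x) (hL : HasBiPath f R B L) : HasBiPath f R B (v :: L) := by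
  classical
  obtain ⟨P, Q, ⟨hP, hQ, hj⟩, hp⟩ := hL
  have hvP : ∀ x ∈ P, f v ≠ f x := fun x hx => hv x (hp.subset (by simp [hx]))
  have hvQ : ∀ x ∈ Q, f v ≠ f x := fun x hx => hv x (hp.subset (by simp [hx]))
  suffices HasBiPath f R B (v :: (P ++ Q)) from this.perm (hp.cons v)
  rcases eq_or_ne P [] with rfl | hPne
  · exact ⟨[v], Q, ⟨by simp, hQ, by simpa using fun y hy => hvQ y (List.mem_of_mem_head? hy)⟩,
      by simp⟩
  obtain ⟨P, p, rfl⟩ := exists_snoc_of_ne_nil hPne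
  rcases Q with _ | ⟨q, Q⟩
  · exact ⟨P ++ [p], [v], ⟨hP, by simp, by simpa using (hvP p (by simp)).symm⟩,
      by rw [List.append_nil]; exact List.perm_append_comm (l₂ := [v])⟩
  obtain ⟨x, y, hs⟩ := IsSeg.exists_of_ne_nil hP (by simp)
  obtain rfl : p = y := by simpa using hs.last
  rcases h.cover v p (hvP p (by simp)) with hr | hb
  · refine ⟨P ++ [p] ++ [v], q :: Q, ⟨(hs.snoc (h.red_symm _ _ hr)).chain, hQ, ?_⟩, ?_⟩
    · simpa using hvQ q (by simp)
    · rw [List.perm_iff_count]; intro x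
      simp only [List.count_append, List.count_cons, List.count_nil]; omega
  rcases h.cover v q (hvQ q (by simp)) with hr | hb'
  · rcases h.cover p q (by simpa using hj) with hr' | hb'
    · refine ⟨P ++ [p] ++ [q] ++ [v], Q, ⟨((hs.snoc hr').snoc (h.red_symm _ _ hr)).chain,
        hQ.tail, ?_⟩, ?_⟩
      · simpa using fun y hy => hvQ y (by simp [List.mem_of_mem_head? hy])
      · rw [List.perm_iff_count]; intro x
        simp only [List.count_append, List.count_cons, List.count_nil]; omega
    · refine ⟨P, v :: p :: q :: Q, ⟨(List.isChain_append.1 hP).1, by simp_all, ?_⟩, ?_⟩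
      · simpa using fun y hy => (hvP y (by simp [List.mem_of_getLast? hy])).symm
      · rw [List.perm_iff_count]; intro x
        simp only [List.count_append, List.count_cons, List.count_nil]; omega
  · refine ⟨P ++ [p], v :: q :: Q, ⟨hP, by simp_all, ?_⟩, ?_⟩
    · simpa using (hvP p (by simp)).symm
    · rw [List.perm_iff_count]; intro x
      simp only [List.count_append, List.count_cons, List.count_nil]; omega

theorem HasSplit.hasBiPath_cons (h : TwoColoured f R B) {i j : Fin 3} (hij : i ≠ j) {v : V}
    {L : List V} (hv : ∀ x ∈ L, f v ≠ f x) (hc : L.countP (f · = i) = L.countP (f · = j))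
    (hL : HasSplit f R B i j L) : HasBiPath f R B (v :: L) := by
  classical
  obtain ⟨A, A', D, D', hp, hA, hA', hD, hD', hAi, hAi', hDj, hDj', hAD, hAD', hb, hb'⟩ := hL
  have hlen : A.length + A'.length = D.length + D'.length := by
    rw [← hp.countP_eq, ← hp.countP_eq] at hc
    simpa [countP_of_forall hAi, countP_of_forall hAi', countP_of_forall hDj,
      countP_of_forall hDj', hij, hij.symm] using hc
  have blue : ∀ x y, (x ∈ A ∨ x ∈ D') → (y ∈ A' ∨ y ∈ D) → B v x → B v y →
      HasBiPath f R B (v :: L) := by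
    intro x y hx hy hvx hvy
    refine HasBiPath.swap h.swap (HasBiPath.perm (hasBiPath_of_split h.swap (m := [v]) hb' hb hAD'
      hAD (by omega) hA hA' hD' hD hx hy (IsSeg.cons (h.blue_symm _ _ hvx) (IsSeg.pair hvy)))
      (List.Perm.trans (List.perm_iff_count.2 fun w => ?_) (hp.cons v)))
    simp only [List.count_append, List.count_nil, List.count_cons]
    omega
  have cov : ∀ x, x ∈ A ∨ x ∈ A' ∨ x ∈ D ∨ x ∈ D' → ¬ R v x → B v x := fun x hx hr =>
    (h.cover v x (hv x (hp.subset (by simpa using hx)))).resolve_left hr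
  by_cases h1 : ∃ x, (x ∈ A ∨ x ∈ D) ∧ R v x
  · by_cases h2 : ∃ y, (y ∈ A' ∨ y ∈ D') ∧ R v y
    · obtain ⟨x, hx, hvx⟩ := h1
      obtain ⟨y, hy, hvy⟩ := h2
      refine HasBiPath.perm (hasBiPath_of_split h (m := [v]) hAD hAD' hb hb' hlen hA hA' hD hD'
        hx hy (IsSeg.cons (h.red_symm _ _ hvx) (IsSeg.pair hvy)))
        (List.Perm.trans (List.perm_iff_count.2 fun w => ?_) (hp.cons v))
      simp only [List.count_append, List.count_nil, List.count_cons]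
      omega
    · push Not at h2
      obtain ⟨a, ha⟩ := List.exists_mem_of_ne_nil _ hA'
      obtain ⟨d, hd⟩ := List.exists_mem_of_ne_nil _ hD'
      exact blue d a (by simp [hd]) (by simp [ha]) (cov d (by simp [hd]) (h2 d (by simp [hd])))
        (cov a (by simp [ha]) (h2 a (by simp [ha])))
  · push Not at h1
    obtain ⟨a, ha⟩ := List.exists_mem_of_ne_nil _ hA
    obtain ⟨d, hd⟩ := List.exists_mem_of_ne_nil _ hD
    exact blue a d (by simp [ha]) (by simp [hd]) (cov a (by simp [ha]) (h1 a (by simp [ha])))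
      (cov d (by simp [hd]) (h1 d (by simp [hd])))

theorem hasBiPath_of_countP_eq_one (h : TwoColoured f R B) {L : List V}
    (hL : ∀ i, 2 * L.countP (f · = i) < L.length) {k : Fin 3} (hk : L.countP (f · = k) = 1) :
    HasBiPath f R B L := by
  classical
  obtain ⟨v, hv, hvk⟩ := List.countP_pos_iff.1 (by omega : 0 < L.countP (f · = k))
  simp only [decide_eq_true_eq] at hvk
  have hp := List.perm_cons_erase hv
  have hk0 : (L.erase v).countP (f · = k) = 0 := by
    rw [hp.countP_eq, List.countP_cons] at hk
    simpa [hvk] using hk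
  have hv' : ∀ x ∈ L.erase v, f v ≠ f x := by
    intro x hx
    have := List.countP_eq_zero.1 hk0 x hx
    simp only [decide_eq_true_eq] at this
    rw [hvk]; exact Ne.symm this
  obtain ⟨i, j, hi, hj, hij⟩ : ∃ i j : Fin 3, i ≠ k ∧ j ≠ k ∧ i ≠ j := by
    clear hL hk hk0 hvk
    revert k; decide
  have hsum := length_eq_sum_countP f L
  have hci := hp.countP_eq (f · = i)
  have hcj := hp.countP_eq (f · = j)
  rw [List.countP_cons] at hci hcj
  simp only [hvk, hi.symm, hj.symm, decide_false, if_false, Bool.false_eq_true] at hci hcj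
  have hc : (L.erase v).countP (f · = i) = (L.erase v).countP (f · = j) := by
    have h0 := hL i
    have h1 := hL j
    have : L.length = L.countP (f · = k) + L.countP (f · = i) + L.countP (f · = j) := by
      clear hL hk hk0 hvk h0 h1 hci hcj
      fin_cases k <;> fin_cases i <;> fin_cases j <;> simp_all <;> omega
    omega
  refine HasBiPath.perm ?_ hp.symm
  rcases hasBiPath_or_hasSplit h hij (L := L.erase v) (fun x hx => by
    rcases fin_three_cases hi hj hij (f x) with h' | h'
    · exact absurd (hvk.trans h'.symm) (hv' x hx)
    · exact h') hc with h' | h'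
  · exact h'.cons_of_forall_ne h hv'
  · exact h'.hasBiPath_cons h hij hv' hc

/-- A fair two-coloured complete tripartite graph has a red path and a blue path covering all its
vertices, with adjacent ends. -/
theorem hasBiPath_of_fair (h : TwoColoured f R B) (L : List V)
    (hL : ∀ i, 2 * L.countP (f · = i) ≤ L.length) (hne : ∀ i, 1 ≤ L.countP (f · = i)) :
    HasBiPath f R B L := by
  classical
  induction hn : L.length using Nat.strong_induction_on generalizing L with
  | _ n ih =>
  by_cases heq : ∃ i, 2 * L.countP (f · = i) = L.length
  · exact hasBiPath_of_countP_eq h hne heq.choose_spec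
  have hlt : ∀ i, 2 * L.countP (f · = i) < L.length := fun i =>
    lt_of_le_of_ne (hL i) fun h' => heq ⟨i, h'⟩
  by_cases hone : ∃ i, L.countP (f · = i) = 1
  · exact hasBiPath_of_countP_eq_one h hlt hone.choose_spec
  have h2 : ∀ i, 2 ≤ L.countP (f · = i) := fun i =>
    lt_of_le_of_ne (hne i) fun h' => hone ⟨i, h'.symm⟩
  have hmem : ∀ i, ∃ x ∈ L, f x = i := fun i => by
    simpa using List.countP_pos_iff.1 (hne i)
  obtain ⟨x, hx, hx0⟩ := hmem 0
  obtain ⟨y, hy, hy1⟩ := hmem 1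
  obtain ⟨z, hz, hz2⟩ := hmem 2
  have hy' : y ∈ L.erase x := (List.mem_erase_of_ne (by grind)).2 hy
  have hz' : z ∈ (L.erase x).erase y :=
    (List.mem_erase_of_ne (by grind)).2 ((List.mem_erase_of_ne (by grind)).2 hz)
  set L' := ((L.erase x).erase y).erase z
  have hp : L.Perm (L' ++ [x, y, z]) := by
    refine (List.perm_cons_erase hx).trans (List.Perm.trans
      (((List.perm_cons_erase hy').trans ((List.perm_cons_erase hz').cons y)).cons x) ?_)
    exact List.perm_append_comm (l₁ := [x, y, z])
  have hlen := hp.length_eq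
  have hcount : ∀ i, L.countP (f · = i) = L'.countP (f · = i) + 1 := by
    intro i
    rw [hp.countP_eq, List.countP_append]
    simp only [List.countP_cons, List.countP_nil, hx0, hy1, hz2]
    fin_cases i <;> simp
  simp only [List.length_append, List.length_cons, List.length_nil] at hlen
  obtain ⟨P, Q, hPQ, hp'⟩ := ih _ (by omega) L' (fun i => by have := hlt i; have := hcount i; omega)
    (fun i => by have := h2 i; have := hcount i; omega) rfl
  exact hasBiPath_of_transversalBiPath h hlt h2 ⟨hPQ, x, y, z, by simp [hx0, hy1],
    by simp [hx0, hz2], by simp [hy1, hz2], (hp'.append_right _).trans hp.symm⟩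

/-- `T` is the vertex list of a cycle in the relation `r`, possibly with fewer than three
vertices. -/
def ClosedPath {V : Type*} (r : V → V → Prop) (T : List V) : Prop :=
  T.IsChain r ∧ (3 ≤ T.length → ∀ x ∈ T.head?, ∀ y ∈ T.getLast?, r y x)

/-- All but at most one of the vertices of `L` are covered by a path in `r` and a cycle in `s`. -/
def HasPathCycle {V : Type*} (r s : V → V → Prop) (L : List V) : Prop :=
  ∃ P T X : List V, P.IsChain r ∧ ClosedPath s T ∧ X.length ≤ 1 ∧ (P ++ T ++ X).Perm L

theorem IsSeg.closedPath {r : V → V → Prop} {x y : V} {T : List V} (hT : IsSeg r x y T)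
    (hyx : r y x) : ClosedPath r T :=
  ⟨hT.chain, fun _ => by simpa [hT.head, hT.last] using hyx⟩

theorem hasPathCycle_of_maximal (h : TwoColoured f R B) {L P Q : List V}
    (hPQ : BiPath f R B P Q) (hp : (P ++ Q).Perm L)
    (hmax : ∀ P' Q', BiPath f R B P' Q' → (P' ++ Q').Perm L → P'.length ≤ P.length) :
    HasPathCycle R B L ∨ HasPathCycle B R L := by
  classical
  rcases eq_or_ne P [] with rfl | hPne
  · exact Or.inr ⟨Q, [], [], hPQ.2.1, ⟨by simp, by simp⟩, by simp, by simpa using hp⟩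
  rcases eq_or_ne Q [] with rfl | hQne
  · exact Or.inl ⟨P, [], [], hPQ.1, ⟨by simp, by simp⟩, by simp, by simpa using hp⟩
  obtain ⟨p, p', hP⟩ := IsSeg.exists_of_ne_nil hPQ.1 hPne
  obtain ⟨q, q', hQ⟩ := IsSeg.exists_of_ne_nil hPQ.2.1 hQne
  have hj : f p' ≠ f q := hPQ.2.2 p' hP.last q hQ.head
  have hs := h.red_symm
  have hs' := h.blue_symm
  have hpL : ∀ {X : List V}, (∀ v, X.count v = P.count v + Q.count v) → X.Perm L := fun hX =>
    (List.perm_iff_count.2 fun v => by rw [hX v, List.count_append]).trans hp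
  have noext : ∀ {P' Q' : List V} {a b c d : V}, IsSeg R a b P' → IsSeg B c d Q' → P'.Perm P →
      Q'.Perm Q → R b c → False := by
    intro P' Q' a b c d hP' hQ' hpP hpQ hbc
    obtain ⟨Q'', hQ'', hne⟩ : ∃ Q'', Q' = c :: Q'' ∧ Q''.IsChain B ∧
        ∀ y ∈ Q''.head?, f c ≠ f y := by
      rcases hQ'.uncons with ⟨h1, rfl⟩ | ⟨z, m, h1, hcz, hm⟩
      · exact ⟨[], h1, by simp, by simp⟩
      · exact ⟨m, h1, hm.chain, by simpa [hm.head] using h.blue_ne _ _ hcz⟩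
    subst hQ''
    have := hmax (P' ++ [c]) Q'' ⟨(hP'.snoc hbc).chain, hne.1, by simpa using hne.2⟩
      (hpL fun v => by
      have e1 := hpP.count_eq v
      have e2 := hpQ.count_eq v
      simp only [List.count_append, List.count_cons, List.count_nil] at *
      omega)
    simp [hpP.length_eq] at this
  have hPr := hP.reverse hs
  have hQr := hQ.reverse hs'
  have bl : ∀ x y, x = p ∨ x = p' → y = q ∨ y = q' → f x ≠ f y → B x y := by
    intro x y hx hy hxy
    refine (h.cover x y hxy).resolve_left fun hr => ?_
    rcases hx with rfl | rfl <;> rcases hy with rfl | rfl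
    · exact noext hPr hQ (List.reverse_perm _) (List.Perm.refl _) hr
    · exact noext hPr hQr (List.reverse_perm _) (List.reverse_perm _) hr
    · exact noext hP hQ (List.Perm.refl _) (List.Perm.refl _) hr
    · exact noext hP hQr (List.Perm.refl _) (List.reverse_perm _) hr
  have rem : ∀ x, x = p ∨ x = p' → ∃ P' : List V, P'.IsChain R ∧ P.Perm (x :: P') := by
    rintro x (rfl | rfl)
    · obtain ⟨m, rfl⟩ := hP.exists_cons
      exact ⟨m, hPQ.1.tail, List.Perm.refl _⟩
    · obtain ⟨m, rfl⟩ := hP.exists_snoc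
      exact ⟨m, (List.isChain_append.1 hPQ.1).1, List.perm_append_comm (l₂ := [x])⟩
  by_cases ha : ∃ x, (x = p ∨ x = p') ∧ f x ≠ f q ∧ f x ≠ f q'
  · obtain ⟨x, hx, hxq, hxq'⟩ := ha
    obtain ⟨P', hP', hpP⟩ := rem x hx
    refine Or.inl ⟨P', x :: Q, [], hP', (hQ.cons (bl x q hx (Or.inl rfl) hxq)).closedPath
      (hs' _ _ (bl x q' hx (Or.inr rfl) hxq')), by simp, hpL fun v => ?_⟩
    have := hpP.count_eq v
    simp only [List.count_append, List.count_cons, List.count_nil] at *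
    omega
  push Not at ha
  have hp'q' : f p' = f q' := ha p' (Or.inr rfl) hj
  have hqq' : f q ≠ f q' := fun e => hj (hp'q'.trans e.symm)
  have hb := bl p' q (Or.inr rfl) (Or.inl rfl) hj
  by_cases hpq : f p = f q
  · have hb' := bl p q' (Or.inl rfl) (Or.inr rfl) (by rw [hpq]; exact hqq')
    rcases h.cover p' p (by grind) with hr | hbp
    · exact Or.inr ⟨Q, P, [], hQ.chain, hP.closedPath hr, by simp, hpL fun v => by
        simp only [List.count_append, List.count_nil]; omega⟩
    · rcases hP.uncons with ⟨-, rfl⟩ | ⟨z, m, rfl, -, hm⟩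
      · exact absurd hpq hj
      obtain ⟨m, rfl⟩ := hm.exists_snoc
      refine Or.inl ⟨m, Q ++ [p, p'], [], (List.isChain_append.1 hm.chain).1,
        (hQ.append (hs' _ _ hb') (IsSeg.pair (hs' _ _ hbp))).closedPath hb, by simp,
        hpL fun v => ?_⟩
      simp only [List.count_append, List.count_cons, List.count_nil]
      omega
  · have hpq' : f p = f q' := ha p (Or.inl rfl) hpq
    rcases hQ.unsnoc with ⟨-, rfl⟩ | ⟨z, m, rfl, hm, hzq'⟩
    · exact absurd rfl hqq'
    have hz := h.blue_ne _ _ hzq'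
    by_cases hx : ∃ x, (x = p ∨ x = p') ∧ B z x
    · obtain ⟨x, hx, hzx⟩ := hx
      obtain ⟨P', hP', hpP⟩ := rem x hx
      refine Or.inl ⟨P', x :: m, [q'], hP', (hm.cons (bl x q hx (Or.inl rfl) (by grind))).closedPath
        hzx, by simp, hpL fun v => ?_⟩
      have := hpP.count_eq v
      simp only [List.count_append, List.count_cons, List.count_nil] at *
      omega
    · push Not at hx
      have hzp := (h.cover z p (by grind)).resolve_right (hx p (Or.inl rfl))
      have hzp' := (h.cover z p' (by grind)).resolve_right (hx p' (Or.inr rfl))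
      obtain ⟨m, rfl⟩ := hm.exists_snoc
      refine Or.inr ⟨m, z :: P, [q'], (List.isChain_append.1 hm.chain).1,
        (hP.cons hzp).closedPath (hs _ _ hzp'), by simp, hpL fun v => ?_⟩
      simp only [List.count_append, List.count_cons, List.count_nil] at *
      omega

theorem HasBiPath.hasPathCycle (h : TwoColoured f R B) {L : List V} (hL : HasBiPath f R B L) :
    HasPathCycle R B L ∨ HasPathCycle B R L := by
  classical
  let s : ℕ → Prop := fun n => ∃ P Q, BiPath f R B P Q ∧ (P ++ Q).Perm L ∧ P.length = n
  have hbound : ∀ {P Q : List V}, (P ++ Q).Perm L → P.length ≤ L.length := by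
    intro P Q hp
    rw [← hp.length_eq, List.length_append]
    omega
  obtain ⟨P₀, Q₀, hPQ₀, hp₀⟩ := hL
  obtain ⟨P, Q, hPQ, hp, hlen⟩ : s (Nat.findGreatest s L.length) :=
    Nat.findGreatest_spec (hbound hp₀) ⟨_, _, hPQ₀, hp₀, rfl⟩
  refine hasPathCycle_of_maximal h hPQ hp fun P' Q' h1 h2 => ?_
  rw [hlen]
  exact Nat.le_findGreatest (hbound h2) ⟨_, _, h1, h2, rfl⟩

theorem exists_merge {k : ℕ} (hk : 3 ≤ k) {f : V → Fin k} {L : List V}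
    (hne : ∀ i, ∃ x ∈ L, f x = i) (hL : ∀ i, 2 * L.countP (f · = i) ≤ L.length) :
    ∃ g : V → Fin 3, (∀ x y, g x ≠ g y → f x ≠ f y) ∧ (∀ i, 2 * L.countP (g · = i) ≤ L.length) ∧
      ∀ i, 1 ≤ L.countP (g · = i) := by
  classical
  suffices ∃ a b : ℕ, 0 < a ∧ a < b ∧ b < k ∧
      2 * L.countP (fun x => decide ((f x).val < a)) ≤ L.length ∧
      2 * L.countP (fun x => decide (a ≤ (f x).val ∧ (f x).val < b)) ≤ L.length ∧
      2 * L.countP (fun x => decide (b ≤ (f x).val)) ≤ L.length by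
    obtain ⟨a, b, ha, hab, hb, h0, h1, h2⟩ := this
    let g : V → Fin 3 := fun x => if (f x).val < a then 0 else if (f x).val < b then 1 else 2
    have g0 : ∀ x, g x = 0 ↔ (f x).val < a := fun x => by simp only [g]; split_ifs <;> simp_all
    have g1 : ∀ x, g x = 1 ↔ a ≤ (f x).val ∧ (f x).val < b := fun x => by
      simp only [g]; split_ifs <;> simp_all
    have g2 : ∀ x, g x = 2 ↔ b ≤ (f x).val := fun x => by
      simp only [g]; split_ifs <;> simp_all; omega
    refine ⟨g, fun x y hxy hf => hxy (by simp only [g, hf]), fun i => ?_, fun i => ?_⟩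
    · fin_cases i
      · simpa [g0] using h0
      · simpa [g1] using h1
      · simpa [g2] using h2
    · obtain ⟨x, hx, hfx⟩ := hne ⟨0, by omega⟩
      obtain ⟨y, hy, hfy⟩ := hne ⟨a, by omega⟩
      obtain ⟨z, hz, hfz⟩ := hne ⟨b, by omega⟩
      refine List.countP_pos_iff.2 ?_
      fin_cases i
      · exact ⟨x, hx, by simp [g0, hfx, ha]⟩
      · exact ⟨y, hy, by simp [g1, hfy, hab]⟩
      · exact ⟨z, hz, by simp [g2, hfz]⟩
  have hsucc : ∀ t : Fin k, L.countP (fun x => decide ((f x).val < t + 1)) =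
      L.countP (fun x => decide ((f x).val < t)) + L.countP (f · = t) := by
    intro t
    clear hL hne
    induction L with
    | nil => simp
    | cons x L ih =>
      simp only [List.countP_cons, ih, Fin.ext_iff, decide_eq_true_eq]
      split_ifs <;> omega
  have hcompl : ∀ t : ℕ, L.length = L.countP (fun x => decide ((f x).val < t)) +
      L.countP (fun x => decide (t ≤ (f x).val)) := by
    intro t
    clear hL hne hsucc
    induction L with
    | nil => simp
    | cons x L ih =>
      simp only [List.countP_cons, List.length_cons, ih, decide_eq_true_eq]
      split_ifs <;> omega
  let s : ℕ → Prop := fun t => 2 * L.countP (fun x => decide ((f x).val < t)) ≤ L.length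
  have hs0 : s 0 := by simp [s]
  set t := Nat.findGreatest s (k - 1)
  have hst : s t := Nat.findGreatest_spec (Nat.zero_le _) hs0
  have htk : t ≤ k - 1 := Nat.findGreatest_le _
  have h1 := hsucc ⟨0, by omega⟩
  have ht1 : 1 ≤ t := by
    refine Nat.le_findGreatest (by omega) ?_
    have := hL ⟨0, by omega⟩
    simp only [s]
    simp at h1
    simp
    omega
  rcases htk.eq_or_lt with htk | htk
  · refine ⟨1, k - 1, by omega, by omega, by omega, ?_, ?_, ?_⟩
    · have := hL ⟨0, by omega⟩
      simp at h1
      simp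
      omega
    · refine le_trans (Nat.mul_le_mul_left 2 (List.countP_mono_left ?_)) (htk ▸ hst)
      simp
    · have := hL ⟨k - 1, by omega⟩
      convert this using 4 with x
      have := (f x).isLt
      exact decide_eq_decide.2 (by rw [Fin.ext_iff]; simp only; omega)
  · refine ⟨t, t + 1, by omega, by omega, by omega, hst, ?_, ?_⟩
    · have := hL ⟨t, by omega⟩
      convert this using 4 with x
      exact decide_eq_decide.2 (by rw [Fin.ext_iff]; simp only; omega)
    · have h2 : ¬ s (t + 1) := Nat.findGreatest_is_greatest (Nat.lt_succ_self _) (by omega)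
      have := hcompl (t + 1)
      simp only [s] at h2
      omega

theorem IsSeg.exists_walk {G : SimpleGraph V} {c : Sym2 V → Bool} {b : Bool} :
    ∀ {l : List V} {x y : V}, IsSeg (fun x y => G.Adj x y ∧ c s(x, y) = b) x y l →
      ∃ p : G.Walk x y, p.support = l ∧ ∀ e ∈ p.edges, c e = b
  | l, x, y, hl => by
    rcases hl.uncons with ⟨rfl, rfl⟩ | ⟨z, m, rfl, hxz, hm⟩
    · exact ⟨.nil, by simp, by simp⟩
    · obtain ⟨p, hp, hpe⟩ := hm.exists_walk
      exact ⟨.cons hxz.1 p, by simp [hp], by simpa using ⟨hxz.2, hpe⟩⟩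
termination_by l => l.length

theorem isMonoPathSet_of_isChain {G : SimpleGraph V} {c : Sym2 V → Bool} {b : Bool} {P : List V}
    (hP : P.IsChain fun x y => G.Adj x y ∧ c s(x, y) = b) (hn : P.Nodup) :
    IsMonoPathSet G c b {x | x ∈ P} := by
  rcases eq_or_ne P [] with rfl | hne
  · exact Or.inl (by simp)
  obtain ⟨x, y, hxy⟩ := IsSeg.exists_of_ne_nil hP hne
  obtain ⟨p, hp, hpe⟩ := hxy.exists_walk
  exact Or.inr ⟨x, y, p, by rwa [Walk.isPath_def, hp], hpe, by rw [hp]⟩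

theorem isMonoCycleSet_of_closedPath {G : SimpleGraph V} {c : Sym2 V → Bool} {b : Bool}
    {T : List V} (hT : ClosedPath (fun x y => G.Adj x y ∧ c s(x, y) = b) T) (hn : T.Nodup) :
    IsMonoCycleSet G c b {x | x ∈ T} := by
  match T, hT, hn with
  | [], _, _ => exact Or.inl (by simp)
  | [v], _, _ => exact Or.inr (Or.inl ⟨v, by simp⟩)
  | [u, v], hT, _ =>
    have := hT.1
    simp only [List.isChain_cons_cons, List.IsChain.singleton, and_true] at this
    exact Or.inr (Or.inr (Or.inl ⟨u, v, this.1, this.2, by ext; simp⟩))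
  | u :: v :: w :: T, hT, hn =>
    obtain ⟨x, y, hxy⟩ := IsSeg.exists_of_ne_nil hT.1 (by simp)
    obtain ⟨p, hp, hpe⟩ := hxy.exists_walk
    have hpp : p.IsPath := by rwa [Walk.isPath_def, hp]
    have hyx := hT.2 (by simp) x hxy.head y hxy.last
    refine Or.inr (Or.inr (Or.inr ⟨y, .cons hyx.1 p, ?_, by simpa using ⟨hyx.2, hpe⟩, ?_⟩))
    · refine (Walk.cons_isCycle_iff _ _).2 ⟨hpp, fun he => ?_⟩
      have h1 := hpp.length_eq_one_of_mem_edges (Sym2.eq_swap ▸ he)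
      have h2 := p.length_support
      rw [hp, h1] at h2
      simp at h2
    · have hy := List.mem_of_getLast? hxy.last
      ext z
      rw [Walk.support_cons, hp]
      refine ⟨fun h => List.mem_cons_of_mem y h, fun h => ?_⟩
      rcases List.mem_cons.1 h with rfl | h
      exacts [hy, h]

theorem HasPathCycle.exists_sets [Fintype V] {G : SimpleGraph V} {c : Sym2 V → Bool}
    {b b' : Bool} {r r' : V → V → Prop} (hr : ∀ x y, r x y → G.Adj x y ∧ c s(x, y) = b)
    (hr' : ∀ x y, r' x y → G.Adj x y ∧ c s(x, y) = b') {L : List V} (hL : L.Nodup)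
    (hmem : ∀ x, x ∈ L) (h : HasPathCycle r r' L) : ∃ S T : Set V, Disjoint S T ∧
      (univ \ (S ∪ T)).ncard ≤ 1 ∧ IsMonoPathSet G c b S ∧ IsMonoCycleSet G c b' T := by
  classical
  obtain ⟨P, T, X, hP, ⟨hT, hT'⟩, hX, hp⟩ := h
  have hn := hp.nodup_iff.2 hL
  rw [List.nodup_append, List.nodup_append] at hn
  refine ⟨{x | x ∈ P}, {x | x ∈ T}, ?_, ?_,
    isMonoPathSet_of_isChain (hP.imp fun x y h => hr x y h) hn.1.1,
    isMonoCycleSet_of_closedPath ⟨hT.imp fun x y h => hr' x y h, fun h3 x hx y hy =>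
      hr' _ _ (hT' h3 x hx y hy)⟩ hn.1.2.1⟩
  · rw [Set.disjoint_left]
    exact fun x hx hx' => hn.1.2.2 x hx x hx' rfl
  · refine le_trans (Set.ncard_le_ncard (t := (X.toFinset : Set V)) ?_ (Finset.finite_toSet _)) ?_
    · intro x hx
      have := hp.mem_iff.2 (hmem x)
      simp at hx this ⊢
      tauto
    · rw [Set.ncard_coe_finset]
      exact (List.toFinset_card_le X).trans hX

end BiPath

/-- Any fair complete `k`-partite graph, `k ≥ 3`, whose edges are coloured red and blue,
contains a vertex-disjoint monochromatic path and monochromatic cycle of distinct colours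
covering all but at most one vertex. -/
theorem stmt1 {V : Type*} [Fintype V] (k : ℕ) (hk : 3 ≤ k)
    (f : V → Fin k) (hf : Function.Surjective f)
    (G : SimpleGraph V) (hG : ∀ x y, G.Adj x y ↔ f x ≠ f y)
    (hfair : ∀ i : Fin k, 2 * ({v | f v = i} : Set V).ncard ≤ Fintype.card V)
    (c : Sym2 V → Bool) :
    ∃ S T : Set V, Disjoint S T ∧ (Set.univ \ (S ∪ T)).ncard ≤ 1 ∧
      ((IsMonoPathSet G c true S ∧ IsMonoCycleSet G c false T) ∨
       (IsMonoPathSet G c false S ∧ IsMonoCycleSet G c true T)) := by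
  classical
  let L : List V := Finset.univ.toList
  have hmem : ∀ x, x ∈ L := fun x => by simp [L]
  have hL : L.Nodup := Finset.nodup_toList _
  have hlen : L.length = Fintype.card V := by simp [L]
  have hcount : ∀ i, L.countP (f · = i) = ({v | f v = i} : Set V).ncard := by
    intro i
    rw [Set.ncard_eq_toFinset_card', List.countP_eq_length_filter,
      ← List.toFinset_card_of_nodup (hL.filter _)]
    congr 1
    ext x
    simp [L]
  obtain ⟨g, hg, hg1, hg2⟩ := exists_merge hk (f := f) (L := L)
    (fun i => (hf i).imp fun x hx => ⟨hmem x, hx⟩) fun i => by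
      rw [hcount, hlen]; exact hfair i
  have h : TwoColoured g (fun x y => g x ≠ g y ∧ c s(x, y) = true)
      fun x y => g x ≠ g y ∧ c s(x, y) = false := by
    refine ⟨fun x y h => ⟨h.1.symm, by rw [Sym2.eq_swap]; exact h.2⟩,
      fun x y h => ⟨h.1.symm, by rw [Sym2.eq_swap]; exact h.2⟩, fun x y h => ?_,
      fun _ _ h => h.1, fun _ _ h => h.1⟩
    cases hc : c s(x, y) <;> simp [h]
  have hr : ∀ (b : Bool) x y, g x ≠ g y ∧ c s(x, y) = b → G.Adj x y ∧ c s(x, y) = b :=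
    fun b x y h => ⟨(hG x y).2 (hg x y h.1), h.2⟩
  rcases (hasBiPath_of_fair h L hg1 hg2).hasPathCycle h with h' | h'
  · obtain ⟨S, T, h1, h2, h3⟩ := h'.exists_sets (hr true) (hr false) hL hmem
    exact ⟨S, T, h1, h2, Or.inl h3⟩
  · obtain ⟨S, T, h1, h2, h3⟩ := h'.exists_sets (hr false) (hr true) hL hmem
    exact ⟨S, T, h1, h2, Or.inr h3⟩
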